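/- Let G be a 1-planar graph that admits a 1-planar drawing in the plane with no ×-crossings (i.e., G ∈ Ĝ). Then the cop-number of G is at most 21. -/

import Mathlib

/-!
Common definitions: the game of Cops and Robbers (strategies, plays, capture,
cop number), 1-planar drawings in the plane, crossings, ×-crossings, kite
edges, guarding of vertices and crossing points, subgraphs of the
planarization, cop territory, robber territory, and the edge sets `S_H(v)`.
-/

namespace CopsRobbersOnePlanar

/-- `f` parametrizes a simple (injective) arc from `p` to `q` over `[0,1]`. -/
structure IsArc (f : ℝ → ℝ × ℝ) (p q : ℝ × ℝ) : Prop where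
  continuousOn : ContinuousOn f (Set.Icc 0 1)
  injOn : Set.InjOn f (Set.Icc 0 1)
  source : f 0 = p
  target : f 1 = q

/-- A 1-planar drawing of a simple graph `G` in the plane: vertices are mapped to
distinct points, each edge to a simple arc joining its endpoints whose interior
avoids all vertices; arcs of distinct edges meet only at shared endpoints or at
interior points; each edge has at most one interior intersection point with the
other arcs (each edge is crossed at most once); arcs of edges sharing an
endpoint do not cross; and no three arcs pass through a common interior point. -/
structure OnePlanarDrawing {V : Type} (G : SimpleGraph V) where
  vpos : V → ℝ × ℝ
  vpos_inj : Function.Injective vpos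
  arc : Sym2 V → ℝ → ℝ × ℝ
  arc_spec : ∀ u v : V, G.Adj u v →
    IsArc (arc s(u, v)) (vpos u) (vpos v) ∨ IsArc (arc s(u, v)) (vpos v) (vpos u)
  arc_avoids_vertices : ∀ e ∈ G.edgeSet, ∀ w : V,
    vpos w ∉ arc e '' Set.Ioo (0 : ℝ) 1
  arcs_meet_properly : ∀ e ∈ G.edgeSet, ∀ f ∈ G.edgeSet, e ≠ f →
    ∀ p ∈ (arc e '' Set.Icc (0 : ℝ) 1) ∩ (arc f '' Set.Icc (0 : ℝ) 1),
      (∃ w : V, w ∈ e ∧ w ∈ f ∧ p = vpos w) ∨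
        p ∈ (arc e '' Set.Ioo (0 : ℝ) 1) ∩ (arc f '' Set.Ioo (0 : ℝ) 1)
  crossed_at_most_once : ∀ e ∈ G.edgeSet,
    Set.Subsingleton {p : ℝ × ℝ | ∃ f ∈ G.edgeSet, f ≠ e ∧
      p ∈ (arc e '' Set.Ioo (0 : ℝ) 1) ∩ (arc f '' Set.Ioo (0 : ℝ) 1)}
  no_adjacent_crossing : ∀ e ∈ G.edgeSet, ∀ f ∈ G.edgeSet, e ≠ f →
    (∃ w : V, w ∈ e ∧ w ∈ f) →
    (arc e '' Set.Ioo (0 : ℝ) 1) ∩ (arc f '' Set.Ioo (0 : ℝ) 1) = ∅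
  no_triple_point : ∀ e ∈ G.edgeSet, ∀ f ∈ G.edgeSet, ∀ g ∈ G.edgeSet,
    e ≠ f → e ≠ g → f ≠ g →
    (arc e '' Set.Ioo (0 : ℝ) 1) ∩ (arc f '' Set.Ioo (0 : ℝ) 1) ∩
      (arc g '' Set.Ioo (0 : ℝ) 1) = ∅

variable {V : Type}

/-- Two edges cross in the drawing `D`: their arcs share an interior point. -/
def OnePlanarDrawing.Crosses {G : SimpleGraph V} (D : OnePlanarDrawing G)
    (e f : Sym2 V) : Prop :=
  e ∈ G.edgeSet ∧ f ∈ G.edgeSet ∧ e ≠ f ∧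
    ((D.arc e '' Set.Ioo (0 : ℝ) 1) ∩ (D.arc f '' Set.Ioo (0 : ℝ) 1)).Nonempty

/-- An edge is uncrossed in the drawing `D`. -/
def OnePlanarDrawing.Uncrossed {G : SimpleGraph V} (D : OnePlanarDrawing G)
    (e : Sym2 V) : Prop :=
  ∀ f, ¬ D.Crosses e f

/-- An ×-crossing: a crossing such that `G` contains no edge joining any two
consecutive endpoints (i.e. endpoints of the two different crossing edges). -/
def OnePlanarDrawing.IsXCrossing {G : SimpleGraph V} (D : OnePlanarDrawing G)
    (e f : Sym2 V) : Prop :=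
  D.Crosses e f ∧ ∀ u w : V, u ∈ e → w ∈ f → ¬ G.Adj u w

/-- The drawing has a kite edge at every crossing: an uncrossed edge of `G`
joining two consecutive endpoints of the crossing. -/
def OnePlanarDrawing.HasKites {G : SimpleGraph V} (D : OnePlanarDrawing G) : Prop :=
  ∀ e f, D.Crosses e f →
    ∃ u w : V, u ∈ e ∧ w ∈ f ∧ G.Adj u w ∧ D.Uncrossed s(u, w)

/-- A strategy for `k` cops on `G`: an initial placement, and a move function
(depending on the current cop positions and the robber's position) under which
every cop either stays put or moves to an adjacent vertex. -/
structure CopStrategy (G : SimpleGraph V) (k : ℕ) where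
  init : Fin k → V
  move : (Fin k → V) → V → Fin k → V
  move_valid : ∀ c r i, move c r i = c i ∨ G.Adj (c i) (move c r i)

/-- A play of the game with `k` cops on `G`: `cop n` is the cop configuration
after the cops' turn of round `n`, and `rob n` is the robber's vertex after the
robber's turn of round `n` (round `0` being the initial placements, cops first).
In each turn every player either stays or moves to an adjacent vertex. -/
structure GamePlay (G : SimpleGraph V) (k : ℕ) where
  cop : ℕ → Fin k → V
  rob : ℕ → V
  cop_valid : ∀ n i, cop (n + 1) i = cop n i ∨ G.Adj (cop n i) (cop (n + 1) i)
  rob_valid : ∀ n, rob (n + 1) = rob n ∨ G.Adj (rob n) (rob (n + 1))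

/-- The cops in the play `π` follow the strategy `cs`. -/
def GamePlay.Follows {G : SimpleGraph V} {k : ℕ} (π : GamePlay G k)
    (cs : CopStrategy G k) : Prop :=
  π.cop 0 = cs.init ∧ ∀ n, π.cop (n + 1) = cs.move (π.cop n) (π.rob n)

/-- The robber is captured at round `n`: some cop occupies the robber's vertex,
either when the robber lands on it, or when the cops move in the key round. -/
def GamePlay.CapturedAt {G : SimpleGraph V} {k : ℕ} (π : GamePlay G k) (n : ℕ) : Prop :=
  ∃ i, π.cop n i = π.rob n ∨ π.cop (n + 1) i = π.rob n

/-- `k` cops have a winning strategy on `G`. -/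
def CopsWin (G : SimpleGraph V) (k : ℕ) : Prop :=
  ∃ cs : CopStrategy G k, ∀ π : GamePlay G k, π.Follows cs → ∃ n, π.CapturedAt n

/-- The cop number of `G`: the least number of cops that can win on `G`. -/
noncomputable def copNumber (G : SimpleGraph V) : ℕ :=
  sInf {k | CopsWin G k}

/-- From time `N` on, the designated cop `i0` guards the vertex `v` in the play
`π`: whenever the robber is on `v`, either he was already captured earlier, or
cop `i0` occupies `v` now or at the key cops' turn (immediate capture). -/
def GamePlay.GuardsVertexBy {G : SimpleGraph V} {k : ℕ} (π : GamePlay G k)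
    (i0 : Fin k) (N : ℕ) (v : V) : Prop :=
  ∀ n, N ≤ n → π.rob n = v →
    (∃ m < n, π.CapturedAt m) ∨ π.cop n i0 = v ∨ π.cop (n + 1) i0 = v

/-- From time `N` on, the cops guard the vertex `v` in the play `π`: the robber
cannot land on `v` (he is captured before) or is captured immediately after
landing on `v`. -/
def GamePlay.GuardsVertex {G : SimpleGraph V} {k : ℕ} (π : GamePlay G k)
    (N : ℕ) (v : V) : Prop :=
  ∀ n, N ≤ n → π.rob n = v →
    (∃ m < n, π.CapturedAt m) ∨ ∃ i, π.cop n i = v ∨ π.cop (n + 1) i = v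

/-- From time `N` on, the cops prevent the robber from traversing the edge `e`
(from one endpoint to the opposite endpoint): the robber was captured before
completing such a move, or is captured immediately after making it.  Guarding a
crossing point means preventing traversal of both edges of the crossing. -/
def GamePlay.GuardsTraversal {G : SimpleGraph V} {k : ℕ} (π : GamePlay G k)
    (N : ℕ) (e : Sym2 V) : Prop :=
  ∀ n, N ≤ n → ∀ u w : V, e = s(u, w) → π.rob n = u → π.rob (n + 1) = w →
    (∃ m < n + 1, π.CapturedAt m) ∨
      ∃ i, π.cop (n + 1) i = w ∨ π.cop (n + 2) i = w

/-- As `GamePlay.GuardsTraversal`, but the capturing cop right after the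
traversal is required to come from the index set `I`. -/
def GamePlay.GuardsTraversalOn {G : SimpleGraph V} {k : ℕ} (π : GamePlay G k)
    (I : Set (Fin k)) (N : ℕ) (e : Sym2 V) : Prop :=
  ∀ n, N ≤ n → ∀ u w : V, e = s(u, w) → π.rob n = u → π.rob (n + 1) = w →
    (∃ m < n + 1, π.CapturedAt m) ∨
      ∃ i ∈ I, π.cop (n + 1) i = w ∨ π.cop (n + 2) i = w

/-- A subgraph `H` of the planarization `G×`, recorded by its vertex set:
`gverts` is its set of `G`-vertices, and `dummies` is the set of crossed edges
of `G` whose crossing point (dummy vertex) belongs to `H`; the latter is closed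
under crossing partners since both edges of a crossing carry the same dummy
vertex. -/
structure PlanSubgraph (G : SimpleGraph V) (D : OnePlanarDrawing G) where
  gverts : Set V
  dummies : Set (Sym2 V)
  dummies_crossed : ∀ e ∈ dummies, ∃ f, D.Crosses e f
  dummies_closed : ∀ e ∈ dummies, ∀ f, D.Crosses e f → f ∈ dummies

/-- The subgraph `H` of `G×` is guarded from time `N` on in the play `π`: all
its `G`-vertices are guarded and all its dummy vertices (crossing points) are
guarded. -/
def GuardedSubgraph {G : SimpleGraph V} {D : OnePlanarDrawing G} {k : ℕ}
    (π : GamePlay G k) (N : ℕ) (H : PlanSubgraph G D) : Prop :=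
  (∀ v ∈ H.gverts, π.GuardsVertex N v) ∧
    (∀ e ∈ H.dummies, π.GuardsTraversal N e)

/-- The edge set of the cop territory `C(H)`: edges `e` of `G` with
`e× ∩ H ≠ ∅`, i.e. an endpoint of `e` is a `G`-vertex of `H`, or the crossing
point of `e` is a dummy vertex of `H`. -/
def copTerritoryEdges {G : SimpleGraph V} {D : OnePlanarDrawing G}
    (H : PlanSubgraph G D) : Set (Sym2 V) :=
  {e | e ∈ G.edgeSet ∧ ((∃ v ∈ e, v ∈ H.gverts) ∨ e ∈ H.dummies)}

/-- The vertex set of the robber territory `R(H)`: the connected component of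
`G` minus the edges of the cop territory that contains the robber's current
vertex `r`. -/
def robberTerritory {G : SimpleGraph V} {D : OnePlanarDrawing G}
    (H : PlanSubgraph G D) (r : V) : Set V :=
  {w | (G.deleteEdges (copTerritoryEdges H)).Reachable r w}

/-- The edge set of the robber territory `R(H)`. -/
def robberTerritoryEdges {G : SimpleGraph V} {D : OnePlanarDrawing G}
    (H : PlanSubgraph G D) (r : V) : Set (Sym2 V) :=
  {e | e ∈ (G.deleteEdges (copTerritoryEdges H)).edgeSet ∧
    ∀ v ∈ e, v ∈ robberTerritory H r}

/-- `S_H(v)` for a `G`-vertex `v` of `H` (with the robber at `r`): the edges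
`e` of `G` joining `v` to a vertex of the robber territory `R(H)` such that
`e× ∩ H = {v}`. -/
def SH {G : SimpleGraph V} {D : OnePlanarDrawing G}
    (H : PlanSubgraph G D) (r v : V) : Set (Sym2 V) :=
  {e | ∃ w : V, e = s(v, w) ∧ G.Adj v w ∧ w ∈ robberTerritory H r ∧
    w ∉ H.gverts ∧ e ∉ H.dummies}

end CopsRobbersOnePlanar

namespace CopsRobbersOnePlanar

section LogChange

open Complex

lemma exists_continuous_log {A : Type*} [TopologicalSpace A] [SimplyConnectedSpace A]
    [LocallyPathConnectedSpace A] [Nonempty A] {f : A → ℂ} (hf : Continuous f)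
    (h0 : ∀ a, f a ≠ 0) : ∃ L : A → ℂ, Continuous L ∧ ∀ a, exp (L a) = f a := by
  obtain ⟨a₀⟩ := ‹Nonempty A›
  obtain ⟨F, ⟨-, hF⟩, -⟩ := isCoveringMapOn_exp.existsUnique_continuousMap_lifts
    ⟨f, hf⟩ (exp_log (h0 a₀)) (fun x ↦ h0 x)
  exact ⟨F, F.continuous, fun a ↦ congrFun hF a⟩

/-- The total change over `[0, 1]` of a continuous logarithm of `f`. -/
noncomputable def logChange (f : ℝ → ℂ) : ℂ :=
  open Classical in
  if h : ∃ L : ℝ → ℂ, Continuous L ∧ ∀ t, exp (L t) = f t then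
    h.choose 1 - h.choose 0 else 0

lemma logChange_eq {f L : ℝ → ℂ} (hL : Continuous L) (hf : ∀ t, exp (L t) = f t) :
    logChange f = L 1 - L 0 := by
  have h : ∃ L : ℝ → ℂ, Continuous L ∧ ∀ t, exp (L t) = f t := ⟨L, hL, hf⟩
  rw [logChange, dif_pos h]
  obtain ⟨hc, he⟩ := h.choose_spec
  set K := h.choose
  have key : ∀ t, ∃ n : ℤ, K t - L t = n * (2 * Real.pi * I) := by
    intro t
    obtain ⟨n, hn⟩ := exp_eq_exp_iff_exists_int.1 ((he t).trans (hf t).symm)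
    exact ⟨n, by rw [hn]; ring⟩
  choose n hn using key
  have hpi : (2 * Real.pi * I : ℂ) ≠ 0 := two_pi_I_ne_zero
  have hcn : Continuous n := by
    rw [Int.isClosedEmbedding_coe_real.isEmbedding.continuous_iff]
    have : (fun t ↦ ((n t : ℤ) : ℝ)) = fun t ↦ ((K t - L t) / (2 * Real.pi * I)).re := by
      funext t
      rw [hn, mul_div_cancel_right₀ _ hpi]
      simp
    change Continuous (fun t ↦ ((n t : ℤ) : ℝ))
    rw [this]
    fun_prop
  have h10 : n 1 = n 0 := PreconnectedSpace.constant inferInstance hcn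
  have h1 := hn 1
  rw [h10, ← hn 0] at h1
  linear_combination h1

lemma logChange_neg {f : ℝ → ℂ} (hf : Continuous f) (h0 : ∀ t, f t ≠ 0) :
    logChange (fun t ↦ -f t) = logChange f := by
  obtain ⟨L, hL, he⟩ := exists_continuous_log hf h0
  rw [logChange_eq hL he, logChange_eq (L := fun t ↦ L t + Real.pi * I) (by fun_prop)
    (fun t ↦ by rw [exp_add, exp_pi_mul_I, he]; ring)]
  ring

lemma logChange_eq_log {f : ℝ → ℂ} (hf : Continuous f) (h0 : ∀ t, f t ≠ 0) :
    ∃ n : ℤ, logChange f = log (f 1) - log (f 0) + 2 * n * (Real.pi * I) := by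
  obtain ⟨L, hL, he⟩ := exists_continuous_log hf h0
  obtain ⟨n, hn⟩ := exp_eq_exp_iff_exists_int.1 ((he 0).trans (exp_log (h0 0)).symm)
  obtain ⟨m, hm⟩ := exp_eq_exp_iff_exists_int.1 ((he 1).trans (exp_log (h0 1)).symm)
  refine ⟨m - n, ?_⟩
  rw [logChange_eq hL he, hn, hm]
  push_cast
  ring

lemma log_sub_log_neg {z : ℂ} (hz : z ≠ 0) :
    ∃ n : ℤ, log z - log (-z) = (2 * n + 1) * (Real.pi * I) := by
  have : exp (log z) = exp (log (-z) + Real.pi * I) := by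
    rw [exp_add, exp_pi_mul_I, exp_log hz, exp_log (neg_ne_zero.2 hz)]; ring
  obtain ⟨n, hn⟩ := exp_eq_exp_iff_exists_int.1 this
  exact ⟨n, by rw [hn]; ring⟩

lemma logChange_square {x y u v : ℂ} (γ : Path x y) (η : Path u v)
    (hd : Disjoint (Set.range γ) (Set.range η)) :
    logChange (fun t ↦ η.extend t - x) + logChange (fun t ↦ γ.extend t - v) =
      logChange (fun t ↦ γ.extend t - u) + logChange (fun t ↦ η.extend t - y) := by
  have hne : ∀ s t : ℝ, η.extend t - γ.extend s ≠ 0 := by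
    intro s t h
    have h1 : γ.extend s ∈ Set.range γ := by rw [← γ.extend_range]; exact ⟨s, rfl⟩
    have h2 : η.extend t ∈ Set.range η := by rw [← η.extend_range]; exact ⟨t, rfl⟩
    exact (Set.disjoint_left.1 hd h1) (by rwa [← sub_eq_zero.1 h])
  have hcγ : Continuous γ.extend := γ.continuous_extend
  have hcη : Continuous η.extend := η.continuous_extend
  obtain ⟨L, hL, he⟩ := exists_continuous_log (A := ℝ × ℝ)
    (f := fun z ↦ η.extend z.2 - γ.extend z.1)
    (by fun_prop) (fun z ↦ hne _ _)
  have γ0 : γ.extend 0 = x := by simp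
  have γ1 : γ.extend 1 = y := by simp
  have η0 : η.extend 0 = u := by simp
  have η1 : η.extend 1 = v := by simp
  have e1 : logChange (fun t ↦ η.extend t - x) = L (0, 1) - L (0, 0) :=
    logChange_eq (L := fun t ↦ L (0, t)) (by fun_prop) (fun t ↦ by rw [he, γ0])
  have e2 : logChange (fun t ↦ η.extend t - y) = L (1, 1) - L (1, 0) :=
    logChange_eq (L := fun t ↦ L (1, t)) (by fun_prop) (fun t ↦ by rw [he, γ1])
  have e3 : logChange (fun t ↦ γ.extend t - v) = L (1, 1) - L (0, 1) := by
    rw [← logChange_neg (by fun_prop) (fun t ↦ by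
      have := hne t 1; rw [η1] at this; intro h; apply this; linear_combination -h)]
    exact logChange_eq (L := fun t ↦ L (t, 1)) (by fun_prop) (fun t ↦ by rw [he, η1]; ring)
  have e4 : logChange (fun t ↦ γ.extend t - u) = L (1, 0) - L (0, 0) := by
    rw [← logChange_neg (by fun_prop) (fun t ↦ by
      have := hne t 0; rw [η0] at this; intro h; apply this; linear_combination -h)]
    exact logChange_eq (L := fun t ↦ L (t, 0)) (by fun_prop) (fun t ↦ by rw [he, η0]; ring)
  rw [e1, e2, e3, e4]
  ring

lemma k33_parity (a b c : Fin 3 → Fin 3 → ℤ) (n m : Fin 3 → Fin 3 → Fin 3 → ℤ)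
    (hc : ∀ i k, i ≠ k → (2 * c k i + 1) = -(2 * c i k + 1))
    (h : ∀ i k j l, i ≠ k → j ≠ l →
      (2 * a i l + 1) + (2 * b k i + 1) + (2 * c l j + 1) - (2 * a k j + 1)
        + 2 * (n i k l + m l i j - n k i j - m j k l) = 0) : False := by
  have c01 := hc 0 1 (by decide)
  have c02 := hc 0 2 (by decide)
  have c12 := hc 1 2 (by decide)
  have h1 := h 0 1 0 1 (by decide) (by decide)
  have h2 := h 0 1 0 2 (by decide) (by decide)
  have h3 := h 0 1 1 2 (by decide) (by decide)
  have h4 := h 0 1 1 0 (by decide) (by decide)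
  have h5 := h 0 1 2 0 (by decide) (by decide)
  have h6 := h 0 1 2 1 (by decide) (by decide)
  have i1 := h 0 2 0 1 (by decide) (by decide)
  have i2 := h 0 2 0 2 (by decide) (by decide)
  have i3 := h 0 2 1 2 (by decide) (by decide)
  have i4 := h 0 2 1 0 (by decide) (by decide)
  have i5 := h 0 2 2 0 (by decide) (by decide)
  have i6 := h 0 2 2 1 (by decide) (by decide)
  have j1 := h 1 2 0 1 (by decide) (by decide)
  have j2 := h 1 2 0 2 (by decide) (by decide)
  have j3 := h 1 2 1 2 (by decide) (by decide)
  have j4 := h 1 2 1 0 (by decide) (by decide)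
  have j5 := h 1 2 2 0 (by decide) (by decide)
  have j6 := h 1 2 2 1 (by decide) (by decide)
  have S : 2 * (2 * (2 * (a 0 0 + a 0 1 + a 0 2 - a 2 0 - a 2 1 - a 2 2)
      + 3 * (b 1 0 + b 2 0 + b 2 1)
      + (n 0 1 0 + n 0 1 1 + n 0 1 2 + n 0 2 0 + n 0 2 1 + n 0 2 2 + n 1 2 0 + n 1 2 1 + n 1 2 2)
      - (n 1 0 0 + n 1 0 1 + n 1 0 2 + n 2 0 0 + n 2 0 1 + n 2 0 2 + n 2 1 0 + n 2 1 1 + n 2 1 2)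
      + (m 1 0 0 + m 2 0 0 + m 2 0 1 + m 0 0 1 + m 0 0 2 + m 1 0 2)
      - (m 1 2 0 + m 2 2 0 + m 2 2 1 + m 0 2 1 + m 0 2 2 + m 1 2 2)) + 9) = 0 := by
    linear_combination h1 + h2 + h3 + h4 + h5 + h6 + i1 + i2 + i3 + i4 + i5 + i6
      + j1 + j2 + j3 + j4 + j5 + j6 - 3 * (c01 + c02 + c12)
  omega

/-- There is no plane realization of `K₃,₃` in which independent edges are disjoint. -/
theorem no_k33_paths {x y : Fin 3 → ℂ} (γ : ∀ i j, Path (x i) (y j))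
    (hd : ∀ i j k l, i ≠ k → j ≠ l → Disjoint (Set.range (γ i j)) (Set.range (γ k l))) :
    False := by
  have hmem0 : ∀ i j, x i ∈ Set.range (γ i j) := fun i j ↦ ⟨0, by simp⟩
  have hmem1 : ∀ i j, y j ∈ Set.range (γ i j) := fun i j ↦ ⟨1, by simp⟩
  have other : ∀ j : Fin 3, ∃ l, l ≠ j := by decide
  have hxγ : ∀ i k l, i ≠ k → x i ∉ Set.range (γ k l) := fun i k l hik h ↦ by
    obtain ⟨j, hj⟩ := other l
    exact Set.disjoint_left.1 (hd i j k l hik hj) (hmem0 i j) h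
  have hyγ : ∀ j k l, j ≠ l → y j ∉ Set.range (γ k l) := fun j k l hjl h ↦ by
    obtain ⟨i, hi⟩ := other k
    exact Set.disjoint_left.1 (hd i j k l hi hjl) (hmem1 i j) h
  have hxx : ∀ i k, i ≠ k → x i ≠ x k := fun i k hik h ↦
    hxγ i k 0 hik (by rw [h]; exact hmem0 k 0)
  have hyy : ∀ i k, i ≠ k → y i ≠ y k := fun i k hik h ↦
    hyγ i 0 k hik (by rw [h]; exact hmem1 0 k)
  have hxy : ∀ i j, x i ≠ y j := fun i j h ↦ by
    obtain ⟨k, hk⟩ := other i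
    exact hxγ i k j hk.symm (by rw [h]; exact hmem1 k j)
  have hext : ∀ k l t, (γ k l).extend t ∈ Set.range (γ k l) := fun k l t ↦ by
    rw [← (γ k l).extend_range]; exact ⟨t, rfl⟩
  have hcont : ∀ k l, Continuous (γ k l).extend := fun k l ↦ (γ k l).continuous_extend
  have hwind : ∀ p k l, p ∉ Set.range (γ k l) → ∃ n : ℤ,
      logChange (fun t ↦ (γ k l).extend t - p) =
        log (y l - p) - log (x k - p) + 2 * n * (Real.pi * I) := by
    intro p k l hp
    have := hcont k l
    simpa using logChange_eq_log (f := fun t ↦ (γ k l).extend t - p) (by fun_prop)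
      (fun t h ↦ hp (by rw [← sub_eq_zero.1 h]; exact hext k l t))
  have hodd : ∀ p q : ℂ, p ≠ q → ∃ n : ℤ,
      log (q - p) - log (p - q) = (2 * n + 1) * (Real.pi * I) := by
    intro p q hpq
    simpa using log_sub_log_neg (sub_ne_zero.2 hpq.symm)
  have h1 : ∀ i k l, ∃ n : ℤ, i ≠ k → logChange (fun t ↦ (γ k l).extend t - x i) =
        log (y l - x i) - log (x k - x i) + 2 * n * (Real.pi * I) := fun i k l ↦ by
    by_cases hik : i = k
    · exact ⟨0, fun h ↦ (h hik).elim⟩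
    · obtain ⟨n, hn⟩ := hwind _ _ _ (hxγ i k l hik)
      exact ⟨n, fun _ ↦ hn⟩
  have h2 : ∀ j k l, ∃ n : ℤ, j ≠ l → logChange (fun t ↦ (γ k l).extend t - y j) =
        log (y l - y j) - log (x k - y j) + 2 * n * (Real.pi * I) := fun i k l ↦ by
    by_cases hik : i = l
    · exact ⟨0, fun h ↦ (h hik).elim⟩
    · obtain ⟨n, hn⟩ := hwind _ _ _ (hyγ i k l hik)
      exact ⟨n, fun _ ↦ hn⟩
  have h3 : ∀ i k, ∃ n : ℤ, i ≠ k → log (x k - x i) - log (x i - x k) =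
      (2 * n + 1) * (Real.pi * I) := fun i k ↦ by
    by_cases hik : i = k
    · exact ⟨0, fun h ↦ (h hik).elim⟩
    · obtain ⟨n, hn⟩ := hodd _ _ (hxx i k hik)
      exact ⟨n, fun _ ↦ hn⟩
  have h4 : ∀ i k, ∃ n : ℤ, i ≠ k → log (y k - y i) - log (y i - y k) =
      (2 * n + 1) * (Real.pi * I) := fun i k ↦ by
    by_cases hik : i = k
    · exact ⟨0, fun h ↦ (h hik).elim⟩
    · obtain ⟨n, hn⟩ := hodd _ _ (hyy i k hik)
      exact ⟨n, fun _ ↦ hn⟩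
  have h5 : ∀ i k, ∃ n : ℤ, log (y k - x i) - log (x i - y k) =
      (2 * n + 1) * (Real.pi * I) := fun i k ↦ hodd _ _ (hxy i k)
  choose n hn using h1
  choose m hm using h2
  choose b hb using h3
  choose c hc using h4
  choose a ha using h5
  have hpi : (Real.pi * I : ℂ) ≠ 0 := by simp [Real.pi_ne_zero]
  have anti : ∀ (b : Fin 3 → Fin 3 → ℤ) (z : Fin 3 → ℂ),
      (∀ i k, i ≠ k → log (z k - z i) - log (z i - z k) = (2 * b i k + 1) * (Real.pi * I)) →
      ∀ i k, i ≠ k → (2 * b k i + 1) = -(2 * b i k + 1) := by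
    intro b z h i k hik
    have e : ((2 * b k i + 1 : ℤ) : ℂ) * (Real.pi * I) =
        ((-(2 * b i k + 1) : ℤ) : ℂ) * (Real.pi * I) := by
      push_cast
      linear_combination -h i k hik - h k i hik.symm
    exact_mod_cast mul_right_cancel₀ hpi e
  refine k33_parity a b c n m (anti c y hc) fun i k j l hik hjl ↦ ?_
  have sq := logChange_square (γ i j) (γ k l) (hd i j k l hik hjl)
  rw [hn i k l hik, hm l i j hjl.symm, hn k i j hik.symm, hm j k l hjl] at sq
  have e : (((2 * a i l + 1) + (2 * b k i + 1) + (2 * c l j + 1) - (2 * a k j + 1)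
        + 2 * (n i k l + m l i j - n k i j - m j k l) : ℤ) : ℂ) * (Real.pi * I) =
      ((0 : ℤ) : ℂ) * (Real.pi * I) := by
    push_cast
    linear_combination sq - ha i l + ha k j - hb k i hik.symm - hc l j hjl.symm
  exact_mod_cast mul_right_cancel₀ hpi e

end LogChange

section Minor

open Relation

variable {N : Type*}

/-- Any two points of `S` are linked by a chain of `A`-related points of `S`. -/
def ConnIn (A : N → N → Prop) (S : Set N) : Prop :=
  ∀ a ∈ S, ∀ b ∈ S, ReflTransGen (fun u v ↦ A u v ∧ u ∈ S ∧ v ∈ S) a b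

/-- The relation `A` has no `K₃,₃` minor. -/
def NoK33Minor (A : N → N → Prop) : Prop :=
  ∀ X Y : Fin 3 → Set N, (∀ i, ConnIn A (X i)) → (∀ j, ConnIn A (Y j)) →
    (∀ i j, i ≠ j → Disjoint (X i) (X j)) → (∀ i j, i ≠ j → Disjoint (Y i) (Y j)) →
    (∀ i j, Disjoint (X i) (Y j)) → (∀ i j, ∃ a ∈ X i, ∃ b ∈ Y j, A a b) → False

theorem noK33Minor_of_arcs {A : N → N → Prop} (pos : N → ℝ × ℝ) (arcs : N → N → Set (ℝ × ℝ))
    (hjoin : ∀ a b, A a b → JoinedIn (arcs a b) (pos a) (pos b))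
    (hdisj : ∀ a b c d, A a b → A c d → a ≠ c → a ≠ d → b ≠ c → b ≠ d →
      Disjoint (arcs a b) (arcs c d)) : NoK33Minor A := by
  intro X Y hX hY hXX hYY hXY hadj
  let E : Set N → Set (ℝ × ℝ) := fun S ↦ {p | ∃ a ∈ S, ∃ b ∈ S, A a b ∧ p ∈ arcs a b}
  have hE : ∀ S S', Disjoint S S' → Disjoint (E S) (E S') := by
    intro S S' h
    have hne : ∀ a ∈ S, ∀ c ∈ S', a ≠ c := fun a ha c hc e ↦
      Set.disjoint_left.1 h ha (e ▸ hc)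
    refine Set.disjoint_left.2 ?_
    rintro p ⟨a, ha, b, hb, hab, hp⟩ ⟨c, hc, d, hd, hcd, hp'⟩
    exact Set.disjoint_left.1 (hdisj a b c d hab hcd (hne _ ha _ hc) (hne _ ha _ hd)
      (hne _ hb _ hc) (hne _ hb _ hd)) hp hp'
  have hchain : ∀ S a b, ReflTransGen (fun u v ↦ A u v ∧ u ∈ S ∧ v ∈ S) a b →
      a = b ∨ JoinedIn (E S) (pos a) (pos b) := by
    intro S a b h
    induction h with
    | refl => exact Or.inl rfl
    | @tail c d _ hcd ih =>
      have step : JoinedIn (E S) (pos c) (pos d) :=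
        (hjoin _ _ hcd.1).mono fun p hp ↦ ⟨c, hcd.2.1, d, hcd.2.2, hcd.1, hp⟩
      rcases ih with rfl | ih
      · exact Or.inr step
      · exact Or.inr (ih.trans step)
  choose x hx using fun i ↦ let ⟨a, ha, _⟩ := hadj i 0; (⟨a, ha⟩ : ∃ a, a ∈ X i)
  choose y hy using fun j ↦ let ⟨_, _, b, hb, _⟩ := hadj 0 j; (⟨b, hb⟩ : ∃ b, b ∈ Y j)
  have hmono : ∀ S S' : Set N, S ⊆ S' → ∀ a b,
      ReflTransGen (fun u v ↦ A u v ∧ u ∈ S ∧ v ∈ S) a b →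
      ReflTransGen (fun u v ↦ A u v ∧ u ∈ S' ∧ v ∈ S') a b := fun S S' h a b hab ↦
    ReflTransGen.mono (fun u v huv ↦ ⟨huv.1, h huv.2.1, h huv.2.2⟩) _ _ hab
  have hpath : ∀ i j, JoinedIn (E (X i ∪ Y j)) (pos (x i)) (pos (y j)) := by
    intro i j
    obtain ⟨a, ha, b, hb, hab⟩ := hadj i j
    have h1 := hmono _ (X i ∪ Y j) Set.subset_union_left _ _ (hX i _ (hx i) _ ha)
    have h2 := hmono _ (X i ∪ Y j) Set.subset_union_right _ _ (hY j _ hb _ (hy j))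
    rcases hchain _ _ _ ((h1.tail ⟨hab, Or.inl ha, Or.inr hb⟩).trans h2) with h | h
    · exact (Set.disjoint_left.1 (hXY i j) (hx i) (h ▸ hy j)).elim
    · exact h
  have hcont : Continuous Complex.equivRealProdCLM.symm :=
    Complex.equivRealProdCLM.symm.continuous
  refine no_k33_paths (fun i j ↦ (hpath i j).somePath.map hcont) fun i j k l hik hjl ↦ ?_
  have hd := hE (X i ∪ Y j) (X k ∪ Y l) (by
    rw [Set.disjoint_union_left, Set.disjoint_union_right, Set.disjoint_union_right]
    exact ⟨⟨hXX i k hik, hXY i l⟩, (hXY k j).symm, hYY j l hjl⟩)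
  rw [Set.disjoint_left]
  rintro _ ⟨s, rfl⟩ ⟨t, ht⟩
  have hst : (hpath k l).somePath t = (hpath i j).somePath s :=
    Complex.equivRealProdCLM.symm.injective ht
  exact Set.disjoint_left.1 hd ((hpath i j).somePath_mem s)
    (hst ▸ (hpath k l).somePath_mem t)

end Minor

/-- The incidence relation between elements and the blocks `T d` containing them. -/
def Inc {V D : Type*} (T : D → Set V) : V ⊕ D → V ⊕ D → Prop
  | .inl v, .inr d => v ∈ T d
  | .inr d, .inl v => v ∈ T d
  | _, _ => False

lemma Inc.symm {V D : Type*} {T : D → Set V} {a b : V ⊕ D} (h : Inc T a b) : Inc T b a := by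
  rcases a with a | a <;> rcases b with b | b <;> exact h

/-- A covering of the edges of `G` by small blocks, the combinatorial content of a 1-planar
drawing without ×-crossings: each block consists of the endpoints of an uncrossed edge
or of a crossing. -/
structure HubSystem {V : Type*} (G : SimpleGraph V) (D : Type*) where
  T : D → Set V
  cover : ∀ u v, G.Adj u v → ∃ d, u ∈ T d ∧ v ∈ T d
  kite : ∀ d, ∃ s ∈ T d, ∃ y a b, G.Adj s a ∧ G.Adj s b ∧
    ∀ t ∈ T d, t = y ∨ t = s ∨ t = a ∨ t = b
  noK33 : NoK33Minor (Inc T)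

namespace OnePlanarDrawing

open Set

variable {V : Type} {G : SimpleGraph V} (D : OnePlanarDrawing G)

open Classical in
/-- The parameter of the crossing on `e`, or `1 / 2` if there is none. -/
noncomputable def hubParam (e : Sym2 V) : ℝ :=
  if h : ∃ t ∈ Ioo (0 : ℝ) 1, ∃ f ∈ G.edgeSet, f ≠ e ∧ D.arc e t ∈ D.arc f '' Ioo (0 : ℝ) 1
  then h.choose else 1 / 2

/-- The crossing point on `e`, or some interior point of `e` if there is none. -/
noncomputable def hub (e : Sym2 V) : ℝ × ℝ := D.arc e (D.hubParam e)

lemma hubParam_mem (e : Sym2 V) : D.hubParam e ∈ Ioo (0 : ℝ) 1 := by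
  unfold hubParam
  split_ifs with h
  · exact h.choose_spec.1
  · norm_num

lemma hub_mem (e : Sym2 V) : D.hub e ∈ D.arc e '' Ioo (0 : ℝ) 1 :=
  ⟨_, D.hubParam_mem e, rfl⟩

lemma hub_eq {e f : Sym2 V} (he : e ∈ G.edgeSet) (hf : f ∈ G.edgeSet) (hne : f ≠ e)
    {p : ℝ × ℝ} (hp : p ∈ D.arc e '' Ioo (0 : ℝ) 1) (hp' : p ∈ D.arc f '' Ioo (0 : ℝ) 1) :
    D.hub e = p := by
  obtain ⟨t, ht, rfl⟩ := hp
  have h : ∃ t ∈ Ioo (0 : ℝ) 1, ∃ f ∈ G.edgeSet, f ≠ e ∧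
      D.arc e t ∈ D.arc f '' Ioo (0 : ℝ) 1 := ⟨t, ht, f, hf, hne, hp'⟩
  have hc : D.hub e = D.arc e h.choose := by rw [hub, hubParam, dif_pos h]
  rw [hc]
  obtain ⟨h1, f', hf', hne', h2⟩ := h.choose_spec
  exact D.crossed_at_most_once e he ⟨f', hf', hne', ⟨_, h1, rfl⟩, h2⟩
    ⟨f, hf, hne, ⟨t, ht, rfl⟩, hp'⟩

/-- The endpoints of the edges through the point `d`. -/
def block (d : (D.hub '' G.edgeSet : Set (ℝ × ℝ))) : Set V :=
  {v | ∃ e ∈ G.edgeSet, v ∈ e ∧ D.hub e = d}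

lemma exists_param {e : Sym2 V} (he : e ∈ G.edgeSet) {v : V} (hv : v ∈ e) :
    ∃ t : ℝ, (t = 0 ∨ t = 1) ∧ D.arc e t = D.vpos v := by
  induction e with | _ a b
  rcases D.arc_spec a b he with h | h <;> rcases Sym2.mem_iff.1 hv with rfl | rfl
  exacts [⟨0, Or.inl rfl, h.source⟩, ⟨1, Or.inr rfl, h.target⟩,
    ⟨1, Or.inr rfl, h.target⟩, ⟨0, Or.inl rfl, h.source⟩]

lemma arc_continuousOn {e : Sym2 V} (he : e ∈ G.edgeSet) :
    ContinuousOn (D.arc e) (Icc 0 1) := by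
  induction e with | _ a b
  rcases D.arc_spec a b he with h | h <;> exact h.continuousOn

lemma exists_half_arc {e : Sym2 V} (he : e ∈ G.edgeSet) {v : V} (hv : v ∈ e) :
    ∃ S : Set (ℝ × ℝ), JoinedIn S (D.vpos v) (D.hub e) ∧ S ⊆ D.arc e '' Icc (0 : ℝ) 1 ∧
      ∀ w, D.vpos w ∈ S → w = v := by
  obtain ⟨t, ht, hvt⟩ := D.exists_param he hv
  have hτ := D.hubParam_mem e
  set τ := D.hubParam e with hτ_def
  have htI : t ∈ Icc (0 : ℝ) 1 := by rcases ht with rfl | rfl <;> norm_num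
  have hsub : segment ℝ t τ ⊆ Icc (0 : ℝ) 1 :=
    (convex_Icc (0 : ℝ) 1).segment_subset htI (Ioo_subset_Icc_self hτ)
  refine ⟨D.arc e '' segment ℝ t τ, ?_, image_mono hsub, ?_⟩
  · have h1 : IsPathConnected (segment ℝ t τ) :=
      (convex_segment t τ).isPathConnected ⟨t, left_mem_segment ℝ t τ⟩
    have h2 := h1.image' ((D.arc_continuousOn he).mono hsub)
    exact h2.joinedIn _ ⟨t, left_mem_segment ℝ t τ, hvt⟩ _ ⟨τ, right_mem_segment ℝ t τ, rfl⟩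
  · rintro w ⟨s, hs, hw⟩
    by_cases hst : s = t
    · exact D.vpos_inj (by rw [← hw, hst, hvt])
    · refine (D.arc_avoids_vertices e he w ⟨s, ?_, hw⟩).elim
      rw [segment_eq_uIcc, mem_uIcc] at hs
      rcases ht with rfl | rfl
      · rcases hs with hs | hs
        · exact ⟨lt_of_le_of_ne hs.1 (Ne.symm hst), hs.2.trans_lt hτ.2⟩
        · linarith [hs.1, hs.2, hτ.1]
      · rcases hs with hs | hs
        · linarith [hs.1, hs.2, hτ.2]
        · exact ⟨hτ.1.trans_le hs.1, lt_of_le_of_ne hs.2 hst⟩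

lemma block_noK33 : NoK33Minor (Inc D.block) := by
  classical
  have key : ∀ (v : V) (d : (D.hub '' G.edgeSet : Set (ℝ × ℝ))), ∃ S : Set (ℝ × ℝ),
      v ∈ D.block d → JoinedIn S (D.vpos v) d ∧ ∃ e ∈ G.edgeSet, D.hub e = d ∧
        S ⊆ D.arc e '' Icc (0 : ℝ) 1 ∧ ∀ w, D.vpos w ∈ S → w = v := by
    intro v d
    by_cases h : v ∈ D.block d
    · obtain ⟨e, he, hv, hd⟩ := h
      obtain ⟨S, h1, h2, h3⟩ := D.exists_half_arc he hv
      exact ⟨S, fun _ ↦ ⟨hd ▸ h1, e, he, hd, h2, h3⟩⟩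
    · exact ⟨∅, fun h' ↦ (h h').elim⟩
  choose S hS using key
  have hd : ∀ v d v' d', v ∈ D.block d → v' ∈ D.block d' → v ≠ v' → d ≠ d' →
      Disjoint (S v d) (S v' d') := by
    intro v d v' d' hv hv' hvv hdd
    obtain ⟨-, e, he, hed, h1, h2⟩ := hS v d hv
    obtain ⟨-, e', he', hed', h1', h2'⟩ := hS v' d' hv'
    have hee : e ≠ e' := by
      rintro rfl
      exact hdd (Subtype.ext (hed.symm.trans hed'))
    refine disjoint_left.2 fun p hp hp' ↦ ?_
    rcases D.arcs_meet_properly e he e' he' hee p ⟨h1 hp, h1' hp'⟩ with ⟨w, -, -, rfl⟩ | ⟨h, h'⟩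
    · exact hvv ((h2 w hp).symm.trans (h2' w hp'))
    · refine hdd (Subtype.ext ?_)
      rw [← hed, ← hed', D.hub_eq he he' hee.symm h h', D.hub_eq he' he hee h' h]
  let arcs : V ⊕ (D.hub '' G.edgeSet : Set (ℝ × ℝ)) → V ⊕ (D.hub '' G.edgeSet : Set (ℝ × ℝ)) →
      Set (ℝ × ℝ)
    | .inl v, .inr d => S v d
    | .inr d, .inl v => S v d
    | _, _ => ∅
  refine noK33Minor_of_arcs (fun n ↦ n.elim D.vpos (fun d ↦ d)) arcs ?_ ?_
  · rintro (a | a) (b | b) hab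
    exacts [hab.elim, (hS _ _ hab).1, (hS _ _ hab).1.symm, hab.elim]
  · rintro (a | a) (b | b) (c | c) (d | d) hab hcd hac had hbc hbd <;>
      first
      | exact hab.elim
      | exact hcd.elim
      | exact hd _ _ _ _ hab hcd (fun h ↦ hac (congrArg _ h)) (fun h ↦ hbd (congrArg _ h))
      | exact hd _ _ _ _ hab hcd (fun h ↦ had (congrArg _ h)) (fun h ↦ hbc (congrArg _ h))
      | exact hd _ _ _ _ hab hcd (fun h ↦ hbc (congrArg _ h)) (fun h ↦ had (congrArg _ h))
      | exact hd _ _ _ _ hab hcd (fun h ↦ hbd (congrArg _ h)) (fun h ↦ hac (congrArg _ h))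

lemma block_kite (hnoX : ∀ e f : Sym2 V, ¬ D.IsXCrossing e f)
    (d : (D.hub '' G.edgeSet : Set (ℝ × ℝ))) :
    ∃ s ∈ D.block d, ∃ y a b, G.Adj s a ∧ G.Adj s b ∧
      ∀ t ∈ D.block d, t = y ∨ t = s ∨ t = a ∨ t = b := by
  obtain ⟨_, e, he, rfl⟩ := d
  by_cases hx : ∃ f ∈ G.edgeSet, e ≠ f ∧ D.hub f = D.hub e
  · obtain ⟨f, hf, hef, hfe⟩ := hx
    have hcr : D.Crosses e f :=
      ⟨he, hf, hef, D.hub e, D.hub_mem e, hfe ▸ D.hub_mem f⟩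
    have hn := hnoX e f
    simp only [IsXCrossing, hcr, true_and, not_forall, not_not] at hn
    obtain ⟨u, w, hu, hw, huw⟩ := hn
    obtain ⟨u', rfl⟩ := hu
    obtain ⟨w', rfl⟩ := hw
    refine ⟨u, ⟨_, he, Sym2.mem_mk_left _ _, rfl⟩, w', u', w, he, huw, ?_⟩
    rintro t ⟨g, hg, htg, hgd⟩
    have : g = s(u, u') ∨ g = s(w, w') := by
      by_contra! hg'
      have := D.no_triple_point _ he _ hf g hg hef hg'.1.symm hg'.2.symm
      refine (eq_empty_iff_forall_notMem.1 this) (D.hub s(u, u')) ⟨⟨D.hub_mem _, ?_⟩, ?_⟩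
      · rw [← hfe]; exact D.hub_mem _
      · rw [← show D.hub g = D.hub s(u, u') from hgd]; exact D.hub_mem _
    rcases this with rfl | rfl <;> rcases Sym2.mem_iff.1 htg with rfl | rfl <;> simp
  · induction e with | _ u v
    refine ⟨u, ⟨_, he, Sym2.mem_mk_left _ _, rfl⟩, u, v, v, he, he, ?_⟩
    rintro t ⟨g, hg, htg, hgd⟩
    have : g = s(u, v) := by
      by_contra hne
      exact hx ⟨g, hg, Ne.symm hne, hgd⟩
    subst this
    rcases Sym2.mem_iff.1 htg with rfl | rfl <;> simp

/-- The blocks of a drawing without ×-crossings. -/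
noncomputable def hubSystem (hnoX : ∀ e f : Sym2 V, ¬ D.IsXCrossing e f) :
    HubSystem G (D.hub '' G.edgeSet : Set (ℝ × ℝ)) where
  T := D.block
  cover u v h := ⟨⟨_, s(u, v), h, rfl⟩, ⟨_, h, Sym2.mem_mk_left _ _, rfl⟩,
    ⟨_, h, Sym2.mem_mk_right _ _, rfl⟩⟩
  kite := D.block_kite hnoX
  noK33 := D.block_noK33

end OnePlanarDrawing

section Game

variable {V : Type} {ι : Type*} {G : SimpleGraph V}

/-- `a` and `b` are equal or adjacent. -/
def Near (G : SimpleGraph V) (a b : V) : Prop := a = b ∨ G.Adj a b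

lemma Near.refl (a : V) : Near G a a := Or.inl rfl

lemma Near.symm {a b : V} (h : Near G a b) : Near G b a :=
  h.elim (fun h ↦ Or.inl h.symm) (fun h ↦ Or.inr h.symm)

variable (G) in
/-- With the cops at `c` to move and the robber at `r`, the cops can capture within `n` rounds. -/
def WinIn : ℕ → (ι → V) → V → Prop
  | 0, c, r => ∃ i, c i = r
  | n + 1, c, r => WinIn n c r ∨ ∃ c' : ι → V, (∀ i, Near G (c i) (c' i)) ∧
      ((∃ i, c' i = r) ∨ ∀ r', Near G r r' → WinIn n c' r')

variable (G) in
/-- The cops, at `c` and to move, have a winning strategy against the robber at `r`. -/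
def Win (c : ι → V) (r : V) : Prop := ∃ n, WinIn G n c r

lemma WinIn.mono {n m : ℕ} (h : n ≤ m) {c : ι → V} {r : V} (hw : WinIn G n c r) :
    WinIn G m c r := by
  induction h with
  | refl => exact hw
  | step _ ih => exact Or.inl ih

lemma Win.of_near [DecidableEq ι] {c : ι → V} {r : V} {i : ι} (h : Near G (c i) r) :
    Win G c r := by
  refine ⟨1, Or.inr ⟨Function.update c i r, fun j ↦ ?_, Or.inl ⟨i, by simp⟩⟩⟩
  by_cases hj : j = i
  · subst hj; simpa using h
  · simpa [hj] using Near.refl _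

lemma Win.step [Finite V] {c c' : ι → V} {r : V} (hc : ∀ i, Near G (c i) (c' i))
    (h : ∀ r', Near G r r' → Win G c' r') : Win G c r := by
  classical
  cases nonempty_fintype V
  choose n hn using h
  let m : V → ℕ := fun r' ↦ if h : Near G r r' then n r' h else 0
  refine ⟨Finset.univ.sup m + 1, Or.inr ⟨c', hc, Or.inr fun r' hr' ↦ ?_⟩⟩
  refine (hn r' hr').mono ?_
  have := Finset.le_sup (f := m) (Finset.mem_univ r')
  simpa [m, hr'] using this

theorem copsWin_of_win {k : ℕ} (e : Fin k ≃ ι) (c₀ : ι → V) (h : ∀ r, Win G c₀ r) :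
    CopsWin G k := by
  have key : ∀ (c : ι → V) (r : V), ∃ c' : ι → V, (∀ i, Near G (c i) (c' i)) ∧
      ∀ n, WinIn G (n + 1) c r → ¬ WinIn G n c r →
        (∃ i, c' i = r) ∨ ∀ r', Near G r r' → WinIn G n c' r' := by
    intro c r
    by_cases hn : ∃ n, WinIn G (n + 1) c r ∧ ¬ WinIn G n c r
    · obtain ⟨n, h1, h2⟩ := hn
      obtain ⟨c', hc', hw⟩ := h1.resolve_left h2
      refine ⟨c', hc', fun m hm1 hm2 ↦ ?_⟩
      have hmn : m = n := by
        rcases lt_trichotomy m n with h | h | h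
        · exact (h2 (hm1.mono h)).elim
        · exact h
        · exact (hm2 (h1.mono h)).elim
      rwa [hmn]
    · exact ⟨c, fun i ↦ Near.refl _, fun n h1 h2 ↦ (hn ⟨n, h1, h2⟩).elim⟩
  choose M hM hW using key
  let cs : CopStrategy G k :=
    { init := c₀ ∘ e
      move := fun c r i ↦ M (c ∘ e.symm) r (e i)
      move_valid := fun c r i ↦ by
        rcases hM (c ∘ e.symm) r (e i) with h | h
        · left; simpa using h.symm
        · right; simpa using h }
  refine ⟨cs, fun π hπ ↦ ?_⟩
  have main : ∀ n m, WinIn G n (π.cop m ∘ e.symm) (π.rob m) → ∃ k, π.CapturedAt k := by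
    intro n
    induction n with
    | zero => exact fun m ⟨i, hi⟩ ↦ ⟨m, e.symm i, Or.inl hi⟩
    | succ n ih =>
      intro m hm
      by_cases hn : WinIn G n (π.cop m ∘ e.symm) (π.rob m)
      · exact ih m hn
      · have hmv : π.cop (m + 1) ∘ e.symm = M (π.cop m ∘ e.symm) (π.rob m) := by
          funext i
          simp [hπ.2 m, cs]
        rcases hW _ _ n hm hn with ⟨i, hi⟩ | h'
        · exact ⟨m, e.symm i, Or.inr (by rw [← hi, ← hmv]; rfl)⟩
        · exact ih (m + 1) (by
            rw [hmv]
            exact h' _ ((π.rob_valid m).elim (fun h ↦ Or.inl h.symm) Or.inr))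
  obtain ⟨n, hn⟩ := h (π.rob 0)
  refine main n 0 ?_
  convert hn using 1
  funext i
  simp [hπ.1, cs]

/-- As long as the robber is in `Z` and each cop `i ∈ B` answers `r` with `g i r`, the robber
can only make moves in `M` and stay in `Z`, or be captured. -/
def Guarding (G : SimpleGraph V) (Z : Set V) (M : V → V → Prop) (B : Set ι) (g : ι → V → V) :
    Prop :=
  ∀ r ∈ Z, ∀ w, Near G r w → (w ∈ Z ∧ M r w) ∨ ∃ i ∈ B, Near G (g i r) w

/-- The map `g` follows the robber along a walk of `G`, at bounded speed for moves in `M`. -/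
def Tracker (G : SimpleGraph V) (M : V → V → Prop) (g : V → V) : Prop :=
  ∃ (N : ℕ) (q : ℕ → V) (φ : V → ℕ), (∀ m, Near G (q m) (q (m + 1))) ∧ (∀ r, φ r ≤ N) ∧
    (∀ r w, M r w → φ r ≤ φ w + 1 ∧ φ w ≤ φ r + 1) ∧ ∀ r, g r = q (φ r)

lemma Tracker.near {M : V → V → Prop} {g : V → V} (h : Tracker G M g) {r w : V} (hrw : M r w) :
    Near G (g r) (g w) := by
  obtain ⟨N, q, φ, hq, -, hφ, hg⟩ := h
  rw [hg, hg]
  obtain ⟨h1, h2⟩ := hφ r w hrw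
  rcases lt_trichotomy (φ r) (φ w) with h | h | h
  · rw [show φ w = φ r + 1 by omega]; exact hq _
  · rw [h]; exact Near.refl _
  · rw [show φ r = φ w + 1 by omega]; exact (hq _).symm

open Classical in
/-- The cops in `B` move to the positions prescribed by `g`, the others stay. -/
noncomputable def answer (B : Set ι) (g : ι → V → V) (c : ι → V) (r : V) : ι → V :=
  fun i ↦ if i ∈ B then g i r else c i

lemma Win.guard_step [Finite V] {Z : Set V} {M : V → V → Prop} {B : Set ι} {g : ι → V → V}
    (hG : Guarding G Z M B g) {c : ι → V} {r : V} (hr : r ∈ Z)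
    (c' : ι → V) (hc' : ∀ i, Near G (c i) (c' i))
    (hB : ∀ i ∈ B, c' i = g i r)
    (h : ∀ w, w ∈ Z → M r w → Win G c' w) : Win G c r := by
  classical
  refine Win.step hc' fun w hw ↦ ?_
  rcases hG r hr w hw with ⟨h1, h2⟩ | ⟨i, hi, h1⟩
  · exact h w h1 h2
  · exact Win.of_near (i := i) (by rwa [hB i hi])

lemma Win.acquire [Finite V] (hconn : G.Connected) {Z : Set V} {M : V → V → Prop} {B : Set ι}
    {g : ι → V → V} (hG : Guarding G Z M B g) (hM : ∀ i ∈ B, ∀ r w, M r w → Near G (g i r) (g i w))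
    {j : ι} (hj : Tracker G M (g j))
    (h : ∀ c r, r ∈ Z → (∀ i, i = j ∨ i ∈ B → Near G (c i) (g i r)) → Win G c r) :
    ∀ c r, r ∈ Z → (∀ i ∈ B, Near G (c i) (g i r)) → Win G c r := by
  classical
  by_cases hjB : j ∈ B
  · exact fun c r hr hc ↦ h c r hr fun i hi ↦ hc i (by rcases hi with rfl | hi <;> assumption)
  obtain ⟨N, q, φ, hq, hN, hφ, hg⟩ := hj
  -- One round in which cop `j` moves to a prescribed neighbour.
  have round : ∀ c r v, r ∈ Z → (∀ i ∈ B, Near G (c i) (g i r)) → Near G (c j) v →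
      (∀ c' w, w ∈ Z → M r w → c' j = v → (∀ i ∈ B, Near G (c' i) (g i w)) → Win G c' w) →
      Win G c r := by
    intro c r v hr hc hv hw
    refine Win.guard_step hG hr (Function.update (answer B g c r) j v) (fun i ↦ ?_)
      (fun i hi ↦ ?_) fun w hwZ hrw ↦ hw _ w hwZ hrw (by simp) fun i hi ↦ ?_
    · by_cases hij : i = j
      · subst hij; simpa using hv
      · by_cases hi : i ∈ B
        · simpa [hij, answer, hi] using hc i hi
        · simpa [hij, answer, hi] using Near.refl _
    · have : i ≠ j := fun e ↦ hjB (e ▸ hi)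
      simp [this, answer, hi]
    · have : i ≠ j := fun e ↦ hjB (e ▸ hi)
      simpa [this, answer, hi] using hM i hi r w hrw
  have done : ∀ c r, r ∈ Z → (∀ i ∈ B, Near G (c i) (g i r)) → Near G (c j) (g j r) →
      Win G c r := fun c r hr hc hcj ↦ h c r hr fun i hi ↦ by
    rcases hi with rfl | hi
    exacts [hcj, hc i hi]
  have phase2 : ∀ k p c r, c j = q p → p ≤ φ r → N ≤ p + k → r ∈ Z →
      (∀ i ∈ B, Near G (c i) (g i r)) → Win G c r := by
    intro k
    induction k with
    | zero =>
      intro p c r hcj hp hk hr hc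
      have : p = φ r := by have := hN r; omega
      exact done c r hr hc (by rw [hcj, hg, this]; exact Near.refl _)
    | succ k ih =>
      intro p c r hcj hp hk hr hc
      by_cases hpr : p = φ r
      · exact done c r hr hc (by rw [hcj, hg, hpr]; exact Near.refl _)
      refine round c r (q (p + 1)) hr hc (hcj ▸ hq p) fun c' w hw hrw hcj' hc' ↦ ?_
      have h2 := (hφ r w hrw).1
      by_cases h3 : p + 1 ≤ φ w
      · exact ih (p + 1) c' w hcj' h3 (by omega) hw hc'
      · refine done c' w hw hc' ?_
        rw [hcj', hg]
        by_cases h4 : φ w = p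
        · rw [h4]; exact (hq p).symm
        · omega
  have phase1 : ∀ k c r, G.dist (c j) (q 0) ≤ k → r ∈ Z →
      (∀ i ∈ B, Near G (c i) (g i r)) → Win G c r := by
    intro k
    induction k with
    | zero =>
      intro c r hk hr hc
      have : c j = q 0 := (hconn.dist_eq_zero_iff).1 (Nat.le_zero.1 hk)
      exact phase2 N 0 c r this (Nat.zero_le _) (by omega) hr hc
    | succ k ih =>
      intro c r hk hr hc
      obtain ⟨p, hp⟩ := hconn.exists_walk_length_eq_dist (c j) (q 0)
      generalize hq0 : q 0 = q₀ at p hp ih hk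
      generalize hcj : c j = v₀ at p hp hk
      cases p with
      | nil => exact phase2 N 0 c r (hcj.trans hq0.symm) (Nat.zero_le _) (by omega) hr hc
      | @cons _ v _ hv p' =>
        refine round c r v hr hc (hcj ▸ Or.inr hv) fun c' w hw hrw hcj' hc' ↦ ih c' w ?_ hw hc'
        rw [hcj']
        have := SimpleGraph.dist_le p'
        simp only [SimpleGraph.Walk.length_cons] at hp
        omega
  exact fun c r hr hc ↦ phase1 _ c r le_rfl hr hc

lemma Win.acquire_finset [Finite V] (hconn : G.Connected) {Z : Set V} {M : V → V → Prop}
    {B : Set ι} {g : ι → V → V} (hG : Guarding G Z M B g)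
    (hM : ∀ i ∈ B, ∀ r w, M r w → Near G (g i r) (g i w))
    (J : Finset ι) (hJ : ∀ j ∈ J, Tracker G M (g j))
    (h : ∀ c r, r ∈ Z → (∀ i, i ∈ J ∨ i ∈ B → Near G (c i) (g i r)) → Win G c r) :
    ∀ c r, r ∈ Z → (∀ i ∈ B, Near G (c i) (g i r)) → Win G c r := by
  classical
  induction J using Finset.induction_on with
  | empty => exact fun c r hr hc ↦ h c r hr fun i hi ↦ hc i (by simpa using hi)
  | @insert j J _ ih =>
    refine ih (fun i hi ↦ hJ i (Finset.mem_insert_of_mem hi)) fun c r hr hc ↦ ?_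
    refine Win.acquire hconn (B := {i | i ∈ J ∨ i ∈ B}) (g := g) (M := M) (Z := Z) ?_ ?_
      (hJ j (Finset.mem_insert_self _ _)) (fun c r hr hc ↦ h c r hr fun i hi ↦ hc i ?_) c r hr hc
    · intro r hr w hw
      rcases hG r hr w hw with h1 | ⟨i, hi, h1⟩
      exacts [Or.inl h1, Or.inr ⟨i, Or.inr hi, h1⟩]
    · rintro i (hi | hi) r w hrw
      exacts [(hJ i (Finset.mem_insert_of_mem hi)).near hrw, hM i hi r w hrw]
    · rw [Finset.mem_insert, or_assoc] at hi
      exact hi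

end Game

section Team

open Relation

lemma exists_geodesic {N : Type*} {H : SimpleGraph N} {a b : N} (h : H.Reachable a b) :
    ∃ (n : ℕ) (q : ℕ → N), q 0 = a ∧ (∀ m, n ≤ m → q m = b) ∧
      (∀ m < n, H.Adj (q m) (q (m + 1))) ∧
      ∀ m ≤ n, ∀ x, ∀ w : H.Walk x (q m), H.dist a x ≤ m + w.length ∧
        m ≤ H.dist a x + w.length := by
  obtain ⟨p, hp⟩ := h.exists_walk_length_eq_dist
  refine ⟨p.length, p.getVert, p.getVert_zero, fun m hm ↦ p.getVert_of_length_le hm,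
    fun m hm ↦ p.adj_getVert_succ hm, fun m hm x w ↦ ⟨?_, ?_⟩⟩
  · refine (SimpleGraph.dist_le ((p.take m).append w.reverse)).trans ?_
    simp only [SimpleGraph.Walk.length_append, SimpleGraph.Walk.length_reverse,
      SimpleGraph.Walk.take_length]
    omega
  · have hr : H.Reachable a x := ⟨(p.take m).append w.reverse⟩
    obtain ⟨p', hp'⟩ := hr.exists_walk_length_eq_dist
    have := SimpleGraph.dist_le ((p'.append w).append (p.drop m))
    simp only [SimpleGraph.Walk.length_append, SimpleGraph.Walk.drop_length] at this
    omega

lemma dist_le_succ_of_adj {N : Type*} {H : SimpleGraph N} {a x y : N} (h : H.Reachable a x)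
    (hxy : H.Adj x y) : H.dist a y ≤ H.dist a x + 1 := by
  obtain ⟨p, hp⟩ := h.exists_walk_length_eq_dist
  simpa [hp] using SimpleGraph.dist_le (p.append hxy.toWalk)

lemma exists_nodup_chain {N : Type*} {A : N → N → Prop} {a b : N} (h : ReflTransGen A a b) :
    ∃ l : List N, (b :: l).IsChain (fun u v ↦ A v u) ∧ (b :: l).Nodup ∧
      (b :: l).getLast? = some a ∧ ∀ z ∈ b :: l, ReflTransGen A a z := by
  induction h with
  | refl => exact ⟨[], by simp, by simp, by simp, by simp [ReflTransGen.refl]⟩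
  | @tail b c hab hbc ih =>
    obtain ⟨l, h1, h2, h3, h4⟩ := ih
    by_cases hc : c ∈ b :: l
    · obtain ⟨l1, l2, hl⟩ := List.append_of_mem hc
      rw [hl] at h1 h2 h3 h4
      exact ⟨l2, h1.right_of_append, h2.of_append_right, by simpa using h3,
        fun z hz ↦ h4 z (List.mem_append_right _ hz)⟩
    · exact ⟨b :: l, List.isChain_cons_cons.2 ⟨hbc, h1⟩, List.nodup_cons.2 ⟨hc, h2⟩,
        by simpa using h3, List.forall_mem_cons.2 ⟨hab.tail hbc, h4⟩⟩

variable {V : Type} {G : SimpleGraph V} {D : Type*} (S : HubSystem G D)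

lemma HubSystem.cross {d : D} {r w y z : V} (hr : r ∈ S.T d) (hw : w ∈ S.T d) (hy : y ∈ S.T d)
    (hz : z ∈ S.T d) (hrw : r ≠ w) (hyz : y ≠ z) (hry : r ≠ y) (hrz : r ≠ z) (hwy : w ≠ y)
    (hwz : w ≠ z) : G.Adj r y ∨ G.Adj r z ∨ G.Adj w y ∨ G.Adj w z := by
  obtain ⟨s, -, t, a, b, hsa, hsb, h⟩ := S.kite d
  have hsa' := hsa.symm
  have hsb' := hsb.symm
  have h1 := h r hr
  have h2 := h w hw
  have h3 := h y hy
  have h4 := h z hz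
  clear h
  grind

/-- Every edge within the block `d` has an endpoint near `s`. -/
def HubSystem.Dom (d : D) (s : V) : Prop :=
  ∀ u ∈ S.T d, ∀ v ∈ S.T d, G.Adj u v → Near G s u ∨ Near G s v

lemma HubSystem.exists_dom (d : D) : ∃ s, S.Dom d s := by
  obtain ⟨s, -, t, a, b, hsa, hsb, h⟩ := S.kite d
  refine ⟨s, fun u hu v hv huv ↦ ?_⟩
  have key : ∀ u ∈ S.T d, u = t ∨ Near G s u := by
    intro u hu
    rcases h u hu with rfl | rfl | rfl | rfl
    exacts [Or.inl rfl, Or.inr (Or.inl rfl), Or.inr (Or.inr hsa), Or.inr (Or.inr hsb)]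
  rcases key u hu with rfl | h1
  · rcases key v hv with rfl | h2
    exacts [(huv.ne rfl).elim, Or.inr h2]
  · exact Or.inl h1

variable (X : Set (V ⊕ D)) (R : Set V)

/-- `u` and `v` lie in a common block outside `X`. -/
def HubSystem.Via (u v : V) : Prop := ∃ d, Sum.inr d ∉ X ∧ u ∈ S.T d ∧ v ∈ S.T d

/-- `r` and `w` are joined by an edge inside `R` whose traversal is not blocked by `X`. -/
def HubSystem.Free (r w : V) : Prop := r ∈ R ∧ w ∈ R ∧ G.Adj r w ∧ S.Via X r w

/-- The vertices of `R` and the blocks outside `X` meeting `R`. -/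
def HubSystem.hat : Set (V ⊕ D) :=
  {z | (∃ r ∈ R, z = .inl r) ∨ ∃ d, z = .inr d ∧ Sum.inr d ∉ X ∧ ∃ r ∈ R, r ∈ S.T d}

/-- The elements of `X` through which the robber may try to leave `R`. -/
def HubSystem.Contact (z : V ⊕ D) : Prop :=
  (∃ w, z = .inl w ∧ Sum.inl w ∈ X ∧ ∃ r ∈ R, G.Adj r w ∧ S.Via X r w) ∨
    ∃ d, z = .inr d ∧ Sum.inr d ∈ X ∧ ∃ r ∈ R, r ∈ S.T d

/-- Seven cops, answering `r` with `g j r`, guard the vertices in `Hot` and the elements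
of `P` against a robber confined to `R`. -/
structure TeamGuards (g : Fin 7 → V → V) (Hot : Set V) (P : Set (V ⊕ D)) : Prop where
  near : ∀ r w, S.Free X R r w → ∀ j, Near G (g j r) (g j w)
  hot : ∀ r w, S.Free X R r w → w ∈ Hot → ∃ j, Near G (g j r) w
  stay : ∀ r, r ∈ R → r ∈ Hot → ∃ j, Near G (g j r) r
  block : ∀ d r w, Sum.inr d ∈ P → r ∈ R → r ∈ S.T d → r ∉ Hot → w ∈ S.T d → G.Adj r w →
    ∃ j, Near G (g j r) w
  vertex : ∀ r w, Sum.inl w ∈ P → r ∈ R → G.Adj r w → S.Via X r w → ∃ j, Near G (g j r) w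

variable {S X R}

lemma HubSystem.Via.mono {X' : Set (V ⊕ D)} (hX : X ⊆ X') {u v : V} (h : S.Via X' u v) :
    S.Via X u v :=
  let ⟨d, h1, h2⟩ := h
  ⟨d, fun h ↦ h1 (hX h), h2⟩

lemma TeamGuards.mono {g : Fin 7 → V → V} {Hot : Set V} {P P' X' : Set (V ⊕ D)} {R' : Set V}
    (h : TeamGuards S X R g Hot P) (hX : X ⊆ X') (hR : R' ⊆ R) (hP : P' ⊆ P) :
    TeamGuards S X' R' g Hot P' where
  near r w hf := h.near r w ⟨hR hf.1, hR hf.2.1, hf.2.2.1, hf.2.2.2.mono hX⟩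
  hot r w hf := h.hot r w ⟨hR hf.1, hR hf.2.1, hf.2.2.1, hf.2.2.2.mono hX⟩
  stay r hr := h.stay r (hR hr)
  block d r w hd hr := h.block d r w (hP hd) (hR hr)
  vertex r w hw hr ha hv := h.vertex r w (hP hw) (hR hr) ha (hv.mono hX)

variable (S X R)

/-- The underlying vertex of a node of the auxiliary graph. -/
def nodeVertex : V ⊕ V × D → V := Sum.elim id Prod.fst

/-- The node `n` belongs to the block `d`. -/
def HubSystem.InBlock : V ⊕ V × D → D → Prop
  | .inl r, d => r ∈ R ∧ r ∈ S.T d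
  | .inr (w, d'), d => d' = d ∧ w ∈ S.T d ∧ w ∉ R ∧ ∃ r ∈ R, r ∈ S.T d

/-- The auxiliary graph: the free moves in `R`, together with a separate copy, for each block
outside `X`, of the vertices of that block outside `R`. -/
def HubSystem.aux : SimpleGraph (V ⊕ V × D) where
  Adj n n' := G.Adj (nodeVertex n) (nodeVertex n') ∧
    ∃ d, Sum.inr d ∉ X ∧ S.InBlock R n d ∧ S.InBlock R n' d
  symm := ⟨fun _ _ h ↦ ⟨h.1.symm, let ⟨d, h1, h2, h3⟩ := h.2; ⟨d, h1, h3, h2⟩⟩⟩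
  loopless := ⟨fun _ h ↦ h.1.ne rfl⟩

/-- The element of `V ⊕ D` represented by a node. -/
def nodeTrace : V ⊕ V × D → V ⊕ D := Sum.elim Sum.inl (fun p ↦ Sum.inr p.2)

variable {S X R}

lemma HubSystem.InBlock.mem {n : V ⊕ V × D} {d : D} (h : S.InBlock R n d) :
    nodeVertex n ∈ S.T d := by
  rcases n with r | ⟨w, d'⟩
  exacts [h.2, h.2.1]

lemma HubSystem.InBlock.exists_mem {n : V ⊕ V × D} {d : D} (h : S.InBlock R n d) :
    ∃ r ∈ R, r ∈ S.T d := by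
  rcases n with r | ⟨w, d'⟩
  exacts [⟨r, h⟩, h.2.2.2]

lemma HubSystem.InBlock.eq_inl {n : V ⊕ V × D} {d : D} (h : S.InBlock R n d)
    (hR : nodeVertex n ∈ R) : n = .inl (nodeVertex n) := by
  rcases n with r | ⟨w, d'⟩
  exacts [rfl, (h.2.2.1 hR).elim]

lemma HubSystem.exists_inBlock {d : D} {r w : V} (hr : r ∈ R) (hrd : r ∈ S.T d)
    (hw : w ∈ S.T d) : ∃ n, S.InBlock R n d ∧ nodeVertex n = w := by
  by_cases h : w ∈ R
  · exact ⟨.inl w, ⟨h, hw⟩, rfl⟩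
  · exact ⟨.inr (w, d), ⟨rfl, hw, h, r, hr, hrd⟩, rfl⟩

lemma HubSystem.Free.aux_adj {r w : V} (h : S.Free X R r w) :
    (S.aux X R).Adj (.inl r) (.inl w) :=
  let ⟨hr, hw, hrw, d, hd, h1, h2⟩ := h
  ⟨hrw, d, hd, ⟨hr, h1⟩, ⟨hw, h2⟩⟩

end Team

section Builder

open Relation

variable {V : Type} {G : SimpleGraph V} {D : Type*} {S : HubSystem G D} {X : Set (V ⊕ D)}
  {R : Set V}

/-- The node `n` lies on, or is attached to, the territory `R`. -/
def HubSystem.Valid (S : HubSystem G D) (X : Set (V ⊕ D)) (R : Set V) (n : V ⊕ V × D) : Prop :=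
  ∃ r ∈ R, n = .inl r ∨ (S.aux X R).Adj n (.inl r)

lemma reachable_of_free (hR : ∀ r ∈ R, ∀ w ∈ R, ReflTransGen (S.Free X R) r w)
    {r w : V} (hr : r ∈ R) (hw : w ∈ R) : (S.aux X R).Reachable (.inl r) (.inl w) := by
  have h := hR r hr w hw
  induction h with
  | refl => exact SimpleGraph.Reachable.refl _
  | tail _ h ih => exact (ih h.1).trans h.aux_adj.reachable

lemma HubSystem.Valid.reachable (hR : ∀ r ∈ R, ∀ w ∈ R, ReflTransGen (S.Free X R) r w)
    {n : V ⊕ V × D} (h : S.Valid X R n) {r : V} (hr : r ∈ R) :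
    (S.aux X R).Reachable n (.inl r) := by
  obtain ⟨w, hw, rfl | h⟩ := h
  · exact reachable_of_free hR hw hr
  · exact h.reachable.trans (reachable_of_free hR hw hr)

theorem exists_team (hR : ∀ r ∈ R, ∀ w ∈ R, ReflTransGen (S.Free X R) r w)
    {n₀ n₁ : V ⊕ V × D} (h0 : S.Valid X R n₀) (h1 : S.Valid X R n₁)
    (hne : n₀ ≠ n₁ ∨ ∃ r ∈ R, n₀ = .inl r) (s₁ s₂ : V) :
    ∃ (g : Fin 7 → V → V) (Hot : Set V) (P : Set (V ⊕ D)) (l : List (V ⊕ D)),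
      TeamGuards S X R g Hot P ∧ (∀ j, Tracker G (fun r w ↦ r = w ∨ S.Free X R r w) (g j)) ∧
      Sum.inl s₁ ∈ P ∧ Sum.inl s₂ ∈ P ∧ (∀ d, S.Dom d s₁ ∨ S.Dom d s₂ → Sum.inr d ∈ P) ∧
      (nodeTrace n₀ :: l).IsChain (Inc S.T) ∧ (nodeTrace n₀ :: l).Nodup ∧
      (nodeTrace n₀ :: l).getLast? = some (nodeTrace n₁) ∧
      (∀ z ∈ nodeTrace n₀ :: l, z ∈ P) ∧ (∀ z ∈ nodeTrace n₀ :: l, z ∈ S.hat X R) ∧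
      ∀ r, Sum.inl r ∈ nodeTrace n₀ :: l → r ∈ Hot := by
  classical
  have h01 : (S.aux X R).Reachable n₀ n₁ :=
    let ⟨r, hr, _⟩ := h0
    (h0.reachable hR hr).trans (h1.reachable hR hr).symm
  obtain ⟨n, q, hq0, hqn, hq, hgeo⟩ := exists_geodesic h01
  set H := S.aux X R with hH
  have hqR : ∀ m ≤ n, ∀ w, q m = .inl w → w ∈ R := by
    intro m hm w hw
    rcases Nat.eq_zero_or_pos m with rfl | hpos
    · obtain ⟨r, hr, rfl | h⟩ := h0
      · rw [hq0] at hw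
        rwa [← Sum.inl_injective hw]
      · obtain ⟨-, d, -, h, -⟩ := h
        rw [← hq0, hw] at h
        exact h.1
    · obtain ⟨-, d, -, -, h⟩ := hq (m - 1) (by omega)
      rw [Nat.sub_add_cancel hpos, hw] at h
      exact h.1
  let f : V → ℕ := fun r ↦ min (H.dist n₀ (.inl r)) n
  let g : Fin 7 → V → V := fun j r ↦
    if (j : ℕ) < 5 then nodeVertex (q (f r + j - 2)) else if (j : ℕ) = 5 then s₁ else s₂
  let Tr : Set (V ⊕ D) := {z | (∃ m ≤ n, ∃ w, q m = .inl w ∧ z = .inl w) ∨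
    ∃ m < n, ∃ d, z = .inr d ∧ Sum.inr d ∉ X ∧ S.InBlock R (q m) d ∧ S.InBlock R (q (m + 1)) d}
  let P : Set (V ⊕ D) := {z | z ∈ Tr ∨ z = .inl s₁ ∨ z = .inl s₂ ∨
    ∃ d, z = .inr d ∧ (S.Dom d s₁ ∨ S.Dom d s₂)}
  let Hot : Set V := {w | (∃ m ≤ n, .inl w = q m ∨ H.Adj (.inl w) (q m)) ∨
    Near G s₁ w ∨ Near G s₂ w}
  have hnearq : ∀ m, Near G (nodeVertex (q m)) (nodeVertex (q (m + 1))) := by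
    intro m
    by_cases hm : m < n
    · exact Or.inr (hq m hm).1
    · rw [hqn m (by omega), hqn (m + 1) (by omega)]
      exact Near.refl _
  have track : ∀ j, Tracker G (fun r w ↦ r = w ∨ S.Free X R r w) (g j) := by
    intro j
    by_cases hj : (j : ℕ) < 5
    · refine ⟨n + 5, nodeVertex ∘ q, fun r ↦ f r + j - 2, hnearq, fun r ↦ ?_, ?_, fun r ↦ ?_⟩
      · have : f r ≤ n := min_le_right _ _
        dsimp only
        omega
      · rintro r w (rfl | h)
        · omega
        · have e1 := dist_le_succ_of_adj (h0.reachable hR h.1) h.aux_adj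
          have e2 := dist_le_succ_of_adj (h0.reachable hR h.2.1) h.aux_adj.symm
          simp only [f, hH]
          omega
      · simp [g, hj]
    · exact ⟨0, fun _ ↦ if (j : ℕ) = 5 then s₁ else s₂, fun _ ↦ 0, fun _ ↦ Near.refl _, by simp,
        by simp, fun r ↦ by simp [g, hj]⟩
  have catch_path : ∀ m ≤ n, ∀ r, ∀ w : H.Walk (.inl r) (q m), w.length ≤ 2 →
      ∃ j, g j r = nodeVertex (q m) := by
    intro m hm r w hw
    obtain ⟨e1, e2⟩ := hgeo m hm _ w
    have hfr : f r = min (H.dist n₀ (.inl r)) n := rfl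
    refine ⟨⟨m + 2 - f r, by omega⟩, ?_⟩
    simp only [g]
    rw [if_pos (by omega), show f r + (m + 2 - f r) - 2 = m by omega]
  have catch₁ : ∀ r w, Near G s₁ w → ∃ j, Near G (g j r) w := fun r w h ↦ ⟨5, by simpa [g] using h⟩
  have catch₂ : ∀ r w, Near G s₂ w → ∃ j, Near G (g j r) w := fun r w h ↦ ⟨6, by simpa [g] using h⟩
  have hinc : ∀ x d, S.InBlock R x d →
      nodeTrace x = .inr d ∨ ∃ w, x = .inl w ∧ Inc S.T (nodeTrace x) (.inr d) := by
    rintro (w | ⟨w, d'⟩) d h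
    · exact Or.inr ⟨w, rfl, h.2⟩
    · exact Or.inl (by rw [h.1]; rfl)
  have hTr0 : nodeTrace (q 0) ∈ Tr := by
    rcases hx : q 0 with w | ⟨w, d⟩
    · exact Or.inl ⟨0, Nat.zero_le _, w, hx, rfl⟩
    · have hn : 0 < n := by
        rcases Nat.eq_zero_or_pos n with hn | hn
        · rcases hne with h | ⟨r, -, h⟩
          · exact (h (by rw [← hq0, hqn 0 (by omega)])).elim
          · rw [← hq0, hx] at h
            cases h
        · exact hn
      obtain ⟨-, e, he, h, h'⟩ := hq 0 hn
      have hde : e = d := by rw [hx] at h; exact h.1.symm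
      exact Or.inr ⟨0, hn, d, rfl, hde ▸ he, hde ▸ h, hde ▸ h'⟩
  have hchain : ∀ m ≤ n, ReflTransGen (fun u v ↦ Inc S.T u v ∧ u ∈ Tr ∧ v ∈ Tr)
      (nodeTrace (q m)) (nodeTrace (q 0)) := by
    intro m
    induction m with
    | zero => exact fun _ ↦ ReflTransGen.refl
    | succ m ih =>
      intro hm
      refine ReflTransGen.trans ?_ (ih (by omega))
      obtain ⟨-, d, hd, h, h'⟩ := hq m (by omega)
      have hdT : Sum.inr d ∈ Tr := Or.inr ⟨m, by omega, d, rfl, hd, h, h'⟩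
      have e1 : ReflTransGen (fun u v ↦ Inc S.T u v ∧ u ∈ Tr ∧ v ∈ Tr)
          (nodeTrace (q (m + 1))) (.inr d) := by
        rcases hinc _ _ h' with e | ⟨w, e, hi⟩
        · rw [e]
        · exact ReflTransGen.single ⟨hi, by rw [e]; exact Or.inl ⟨m + 1, hm, w, e, rfl⟩, hdT⟩
      have e2 : ReflTransGen (fun u v ↦ Inc S.T u v ∧ u ∈ Tr ∧ v ∈ Tr)
          (.inr d) (nodeTrace (q m)) := by
        rcases hinc _ _ h with e | ⟨w, e, hi⟩
        · rw [e]
        · exact ReflTransGen.single ⟨hi.symm, hdT, by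
            rw [e]; exact Or.inl ⟨m, by omega, w, e, rfl⟩⟩
      exact e1.trans e2
  obtain ⟨l, hl1, hl2, hl3, hl4⟩ := exists_nodup_chain (hchain n le_rfl)
  rw [hqn n le_rfl] at hl3
  have hlTr : ∀ z ∈ nodeTrace (q 0) :: l, z ∈ Tr := by
    intro z hz
    have hend : nodeTrace (q n) ∈ Tr := by
      rcases (hchain n le_rfl).cases_head with h | ⟨_, h, -⟩
      · rw [h]; exact hTr0
      · exact h.2.1
    rcases (hl4 z hz).cases_tail with h | ⟨_, -, h⟩
    · rw [h]; rw [← hqn n le_rfl] at *; exact hend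
    · exact h.2.2
  rw [hq0] at hl1 hl2 hl3 hl4 hlTr
  refine ⟨g, Hot, P, l, ?_, track, Or.inr (Or.inl rfl), Or.inr (Or.inr (Or.inl rfl)),
    fun d hd ↦ Or.inr (Or.inr (Or.inr ⟨d, rfl, hd⟩)), hl1.imp fun u v h ↦ h.1.symm, hl2, hl3,
    fun z hz ↦ Or.inl (hlTr z hz), ?_, ?_⟩
  · refine ⟨fun r w hf j ↦ (track j).near (Or.inr hf), ?_, ?_, ?_, ?_⟩
    · rintro r w hf (⟨m, hm, h⟩ | h | h)
      · rcases h with h | h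
        · obtain ⟨j, hj⟩ := catch_path m hm r (hf.aux_adj.toWalk.copy rfl h) (by simp)
          exact ⟨j, by rw [hj, ← h]; exact Near.refl _⟩
        · obtain ⟨j, hj⟩ := catch_path m hm r (.cons hf.aux_adj h.toWalk) (by simp)
          exact ⟨j, by rw [hj]; exact Or.inr h.symm.1⟩
      · exact catch₁ r w h
      · exact catch₂ r w h
    · rintro r hr (⟨m, hm, h⟩ | h | h)
      · rcases h with h | h
        · obtain ⟨j, hj⟩ := catch_path m hm r (SimpleGraph.Walk.nil.copy rfl h) (by simp)
          exact ⟨j, by rw [hj, ← h]; exact Near.refl _⟩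
        · obtain ⟨j, hj⟩ := catch_path m hm r h.toWalk (by simp)
          exact ⟨j, by rw [hj]; exact Or.inr h.symm.1⟩
      · exact catch₁ r r h
      · exact catch₂ r r h
    · intro d r w hd hr hrd hhot hw hrw
      have hdom : ∀ s, S.Dom d s → ¬ Near G s r → Near G s w := fun s hs hn ↦
        (hs r hrd w hw hrw).resolve_left hn
      rcases hd with (⟨m, -, v, -, h⟩ | ⟨m, hm, d', hd', hdX, hb, hb'⟩) | h | h | ⟨d', hd', h | h⟩
      · cases h
      · cases hd'
        have hrb : S.InBlock R (.inl r) d := ⟨hr, hrd⟩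
        obtain ⟨x, hx, rfl⟩ := HubSystem.exists_inBlock hr hrd hw
        have hrx : H.Adj (.inl r) x := ⟨hrw, d, hdX, hrb, hx⟩
        have hadj : ∀ k ≤ n, S.InBlock R (q k) d → ¬ G.Adj r (nodeVertex (q k)) :=
          fun k hk hkb h ↦ hhot (Or.inl ⟨k, hk, Or.inr ⟨h, d, hdX, hrb, hkb⟩⟩)
        have hneq : ∀ k ≤ n, S.InBlock R (q k) d → r ≠ nodeVertex (q k) :=
          fun k hk hkb h ↦ hhot (Or.inl ⟨k, hk, Or.inl (by rw [hkb.eq_inl (h ▸ hr), ← h])⟩)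
        have hfin : ∀ k ≤ n, S.InBlock R (q k) d → G.Adj (nodeVertex x) (nodeVertex (q k)) →
            ∃ j, Near G (g j r) (nodeVertex x) := by
          intro k hk hkb h
          have hxk : H.Adj x (q k) := ⟨h, d, hdX, hx, hkb⟩
          obtain ⟨j, hj⟩ := catch_path k hk r (.cons hrx hxk.toWalk) (by simp)
          exact ⟨j, by rw [hj]; exact Or.inr h.symm⟩
        have hm' : m ≤ n := hm.le
        rcases S.cross hrd hw hb.mem hb'.mem hrw.ne (hq m hm).1.ne (hneq m hm' hb)
          (hneq (m + 1) hm hb') (fun h ↦ hadj m hm' hb (h ▸ hrw))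
          (fun h ↦ hadj (m + 1) hm hb' (h ▸ hrw)) with h | h | h | h
        · exact (hadj m hm' hb h).elim
        · exact (hadj (m + 1) hm hb' h).elim
        · exact hfin m hm' hb h
        · exact hfin (m + 1) hm hb' h
      · cases h
      · cases h
      · cases hd'
        exact catch₁ r w (hdom _ h fun h ↦ hhot (Or.inr (Or.inl h)))
      · cases hd'
        exact catch₂ r w (hdom _ h fun h ↦ hhot (Or.inr (Or.inr h)))
    · rintro r w ((⟨m, hm, v, hv, h⟩ | ⟨m, hm, d', hd', -⟩) | h | h | ⟨d', hd', -⟩) hr hrw hvia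
      · cases h
        have hf : S.Free X R r w := ⟨hr, hqR m hm _ hv, hrw, hvia⟩
        obtain ⟨j, hj⟩ := catch_path m hm r (hf.aux_adj.toWalk.copy rfl hv.symm) (by simp)
        exact ⟨j, by rw [hj, hv]; exact Near.refl _⟩
      · cases hd'
      · cases h
        exact catch₁ r _ (Near.refl _)
      · cases h
        exact catch₂ r _ (Near.refl _)
      · cases hd'
  · intro z hz
    rcases hlTr z hz with ⟨m, hm, w, hw, rfl⟩ | ⟨m, hm, d, rfl, hd, hb, -⟩
    · exact Or.inl ⟨w, hqR m hm w hw, rfl⟩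
    · exact Or.inr ⟨d, rfl, hd, hb.exists_mem⟩
  · intro r hr
    rcases hlTr _ hr with ⟨m, hm, w, hw, h⟩ | ⟨m, hm, d, h, -⟩
    · cases h
      exact Or.inl ⟨m, hm, Or.inl hw.symm⟩
    · cases h

lemma HubSystem.Contact.exists_port (hRX : ∀ r ∈ R, Sum.inl r ∉ X) {a : V ⊕ D}
    (ha : S.Contact X R a) :
    ∃ (n : V ⊕ V × D) (s : V), S.Valid X R n ∧ Inc S.T a (nodeTrace n) ∧
      (∀ P : Set (V ⊕ D), Sum.inl s ∈ P → (∀ d, S.Dom d s → Sum.inr d ∈ P) → a ∈ P) ∧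
      ((∃ w d, a = .inl w ∧ n = .inr (w, d)) ∨ ∃ d, a = .inr d ∧ ∃ r ∈ R, n = .inl r) := by
  rcases ha with ⟨w, rfl, hw, r, hr, hrw, d, hd, hrd, hwd⟩ | ⟨d, rfl, hd, r, hr, hrd⟩
  · exact ⟨.inr (w, d), w, ⟨r, hr, Or.inr ⟨hrw.symm, d, hd,
      ⟨rfl, hwd, fun h ↦ hRX w h hw, r, hr, hrd⟩, ⟨hr, hrd⟩⟩⟩, hwd, fun P h _ ↦ h,
      Or.inl ⟨w, d, rfl, rfl⟩⟩
  · obtain ⟨s, hs⟩ := S.exists_dom d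
    exact ⟨.inl r, s, ⟨r, hr, Or.inl rfl⟩, hrd, fun P _ h ↦ h d hs, Or.inr ⟨d, rfl, r, hr, rfl⟩⟩

/-- Seven cops can guard a path through `R` between two contacts, or from a contact. -/
theorem exists_team_of_contacts (hRX : ∀ r ∈ R, Sum.inl r ∉ X)
    (hR : ∀ r ∈ R, ∀ w ∈ R, ReflTransGen (S.Free X R) r w)
    {a b : V ⊕ D} (ha : S.Contact X R a) (hb : S.Contact X R b) :
    ∃ (g : Fin 7 → V → V) (Hot : Set V) (P : Set (V ⊕ D)) (l : List (V ⊕ D)),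
      TeamGuards S X R g Hot P ∧ (∀ j, Tracker G (fun r w ↦ r = w ∨ S.Free X R r w) (g j)) ∧
      a ∈ P ∧ b ∈ P ∧ l ≠ [] ∧ (a :: l).IsChain (Inc S.T) ∧
      (a ≠ b → (a :: (l ++ [b])).IsChain (Inc S.T)) ∧ l.Nodup ∧
      (∀ z ∈ l, z ∈ P) ∧ (∀ z ∈ l, z ∈ S.hat X R) ∧ ∀ r, Sum.inl r ∈ l → r ∈ Hot := by
  obtain ⟨n, s, hn, hin, hP, hshape⟩ := ha.exists_port hRX
  by_cases hab : a = b
  · obtain ⟨r, hr, -⟩ := id hn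
    have hne : n ≠ .inl r ∨ ∃ r ∈ R, n = .inl r := by
      by_cases h : n = .inl r
      exacts [Or.inr ⟨r, hr, h⟩, Or.inl h]
    obtain ⟨g, Hot, P, l, hg, ht, hs1, -, hd, hl1, hl2, hl3, hl4, hl5, hl6⟩ :=
      exists_team hR hn ⟨r, hr, Or.inl rfl⟩ hne s s
    have haP : a ∈ P := hP P hs1 fun d h ↦ hd d (Or.inl h)
    exact ⟨g, Hot, P, _, hg, ht, haP, hab ▸ haP, List.cons_ne_nil _ _,
      List.isChain_cons_cons.2 ⟨hin, hl1⟩, fun h ↦ (h hab).elim, hl2, hl4, hl5, hl6⟩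
  · obtain ⟨n', s', hn', hin', hP', hshape'⟩ := hb.exists_port hRX
    have hne : n ≠ n' ∨ ∃ r ∈ R, n = .inl r := by
      rcases hshape with ⟨w, d, rfl, rfl⟩ | ⟨d, rfl, h⟩
      · left
        rintro rfl
        rcases hshape' with ⟨w', d', rfl, h⟩ | ⟨d', rfl, r, -, h⟩
        · cases h
          exact hab rfl
        · cases h
      · exact Or.inr h
    obtain ⟨g, Hot, P, l, hg, ht, hs1, hs2, hd, hl1, hl2, hl3, hl4, hl5, hl6⟩ :=
      exists_team hR hn hn' hne s s'
    refine ⟨g, Hot, P, _, hg, ht, hP P hs1 fun d h ↦ hd d (Or.inl h),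
      hP' P hs2 fun d h ↦ hd d (Or.inr h), List.cons_ne_nil _ _,
      List.isChain_cons_cons.2 ⟨hin, hl1⟩, fun _ ↦ ?_, hl2, hl4, hl5, hl6⟩
    refine List.isChain_cons_cons.2 ⟨hin, ?_⟩
    refine List.isChain_append.2 ⟨hl1, List.isChain_singleton _, ?_⟩
    intro x hx y hy
    rw [hl3] at hx
    cases hx
    cases hy
    exact hin'.symm

end Builder

section Contour

open Relation

variable {N : Type*} {A : N → N → Prop}

lemma exists_first_of_mem {C : N → Prop} {l : List N} (h : ∃ z ∈ l, C z) :
    ∃ s a t, l = s ++ a :: t ∧ C a ∧ ∀ z ∈ s, ¬ C z := by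
  induction l with
  | nil => simp at h
  | cons x l ih =>
    by_cases hx : C x
    · exact ⟨[], x, l, rfl, hx, by simp⟩
    · obtain ⟨s, a, t, rfl, ha, hs⟩ := ih (by simpa [hx] using h)
      exact ⟨x :: s, a, t, rfl, ha, List.forall_mem_cons.2 ⟨hx, hs⟩⟩

lemma exists_last_of_mem {C : N → Prop} {l : List N} (h : ∃ z ∈ l, C z) :
    ∃ s a t, l = s ++ a :: t ∧ C a ∧ ∀ z ∈ t, ¬ C z := by
  obtain ⟨s, a, t, hl, ha, hs⟩ := exists_first_of_mem (l := l.reverse) (by simpa using h)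
  refine ⟨t.reverse, a, s.reverse, ?_, ha, by simpa using hs⟩
  rw [← l.reverse_reverse, hl]
  simp

lemma connIn_of_isChain (hA : ∀ u v, A u v → A v u) {l : List N} (h : l.IsChain A) :
    ConnIn A {z | z ∈ l} := by
  induction l with
  | nil => exact fun a ha ↦ by simp at ha
  | cons x l ih =>
    cases l with
    | nil =>
      intro a ha b hb
      simp only [List.mem_singleton, Set.mem_ofPred_eq] at ha hb
      subst ha hb
      exact .refl
    | cons y l =>
      rw [List.isChain_cons_cons] at h
      have ih := ih h.2
      have key : ∀ a ∈ y :: l, ∀ b ∈ y :: l, ReflTransGen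
          (fun u v ↦ A u v ∧ u ∈ x :: y :: l ∧ v ∈ x :: y :: l) a b := fun a ha b hb ↦
        ReflTransGen.mono (fun u v huv ↦ ⟨huv.1, List.mem_cons_of_mem _ huv.2.1,
          List.mem_cons_of_mem _ huv.2.2⟩) _ _ (ih a ha b hb)
      have hy : y ∈ y :: l := List.mem_cons_self
      intro a ha b hb
      rcases List.mem_cons.1 ha with rfl | ha' <;> rcases List.mem_cons.1 hb with rfl | hb'
      · exact .refl
      · exact (key y hy b hb').head ⟨h.1, ha, List.mem_cons_of_mem _ hy⟩
      · exact (key a ha' y hy).tail ⟨hA _ _ h.1, List.mem_cons_of_mem _ hy, hb⟩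
      · exact key a ha' b hb'

lemma isChain_reverse_of_symm (hA : ∀ u v, A u v → A v u) {a b : N} {l : List N}
    (h : (a :: (l ++ [b])).IsChain A) : (b :: (l.reverse ++ [a])).IsChain A := by
  have := List.isChain_reverse.2 (h.imp hA)
  simpa using this

lemma exists_adj_of_isChain {a b : N} {l : List N} (h : (a :: (l ++ [b])).IsChain A)
    (hl : l ≠ []) : ∃ z ∈ l, A a z := by
  cases l with
  | nil => exact (hl rfl).elim
  | cons x l => exact ⟨x, List.mem_cons_self, (List.isChain_cons_cons.1 h).1⟩

/-- If three internally disjoint paths join `a` and `b`, then one of them does not touch a given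
connected set which is disjoint from all of them. -/
lemma exists_free_of_theta (hA : ∀ u v, A u v → A v u) (hK : NoK33Minor A) {a b : N}
    (hab : a ≠ b) (l : Fin 3 → List N) (hl : ∀ j, (a :: (l j ++ [b])).IsChain A)
    (ha : ∀ j, a ∉ l j) (hb : ∀ j, b ∉ l j) (hd : ∀ i j, i ≠ j → (l i).Disjoint (l j))
    {H : Set N} (hH : ConnIn A H) (haH : a ∉ H) (hbH : b ∉ H) (hlH : ∀ j, ∀ z ∈ l j, z ∉ H) :
    ∃ j, ∀ z ∈ l j, ¬ ∃ y ∈ H, A z y := by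
  by_contra! hcon
  choose z hz y hy hzy using hcon
  have hne : ∀ j, l j ≠ [] := fun j ↦ List.ne_nil_of_mem (hz j)
  have hsing : ∀ x : N, ConnIn A {x} := by
    rintro x _ rfl _ rfl
    exact .refl
  refine hK ![{a}, {b}, H] (fun j ↦ {z | z ∈ l j}) ?_ (fun j ↦ ?_) ?_ ?_ ?_ ?_
  · exact Fin.forall_fin_succ.2 ⟨hsing a, Fin.forall_fin_two.2 ⟨hsing b, hH⟩⟩
  · exact connIn_of_isChain hA (hl j).tail.left_of_append
  · simp [Fin.forall_fin_succ, haH, hbH, hab, hab.symm]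
  · intro i j hij
    exact Set.disjoint_left.2 fun z h1 h2 ↦ hd i j hij h1 h2
  · intro i j
    refine Set.disjoint_left.2 fun z h1 h2 ↦ ?_
    fin_cases i
    · cases h1
      exact ha j h2
    · cases h1
      exact hb j h2
    · exact hlH j z h2 h1
  · intro i j
    fin_cases i
    · obtain ⟨z, h1, h2⟩ := exists_adj_of_isChain (hl j) (hne j)
      exact ⟨a, rfl, z, h1, h2⟩
    · obtain ⟨z, h1, h2⟩ := exists_adj_of_isChain (isChain_reverse_of_symm hA (hl j))
        (by simpa using hne j)
      exact ⟨b, rfl, z, List.mem_reverse.1 h1, h2⟩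
    · exact ⟨y j, hy j, z j, hz j, hA _ _ (hzy j)⟩

variable (A) in
/-- The elements satisfying `C` lie on a path guarded by `P₁`, or on a cycle split in two parts
guarded by `P₁` and `P₂`. -/
def Contour (C : N → Prop) (X P₁ P₂ : Set N) : Prop :=
  (∃ l : List N, l.IsChain A ∧ l.Nodup ∧ (∀ z ∈ l, z ∈ X) ∧ ∀ z, C z → z ∈ l ∧ z ∈ P₁) ∨
    ∃ l m : List N, (l ++ m : Cycle N).Chain A ∧ (l ++ m).Nodup ∧ (∀ z ∈ l ++ m, z ∈ X) ∧
      ∀ z, C z → (z ∈ l ∧ z ∈ P₁) ∨ (z ∈ m ∧ z ∈ P₂)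

variable (A) in
/-- A path or cycle as in `Contour`, with a choice of two elements satisfying `C`. -/
structure SplitContour (C : N → Prop) (X P₁ P₂ : Set N) (a b : N) (t u : List N) : Prop where
  left : C a
  right : C b
  chain : (a :: (t ++ [b])).IsChain A
  chain' : u = [] ∨ (b :: (u ++ [a])).IsChain A
  nodup : (a :: (t ++ b :: u)).Nodup
  subset : ∀ z ∈ a :: (t ++ b :: u), z ∈ X
  guard : ∀ z, C z → (z ∈ a :: t ∧ z ∈ P₁) ∨ (z ∈ b :: u ∧ z ∈ P₂)

lemma Contour.mem {C : N → Prop} {X P₁ P₂ : Set N} (h : Contour A C X P₁ P₂) {z : N}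
    (hz : C z) : z ∈ P₁ ∨ z ∈ P₂ := by
  rcases h with ⟨l, -, -, -, h⟩ | ⟨l, m, -, -, -, h⟩
  · exact Or.inl (h z hz).2
  · exact (h z hz).imp And.right And.right

lemma chain_cycle_iff {a b : N} {t u : List N} :
    ((a :: (t ++ b :: u) : List N) : Cycle N).Chain A ↔
      (a :: (t ++ [b])).IsChain A ∧ (b :: (u ++ [a])).IsChain A := by
  rw [Cycle.chain_coe_cons, List.append_assoc, List.cons_append, ← List.cons_append,
    List.isChain_split, List.cons_append]

/-- A cycle all of whose `C`-elements lie on one guarded arc can be split. -/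
lemma exists_split_of_arc {C : N → Prop} {X P : Set N} {l m : List N} {a₀ : N}
    (hc : (l ++ m : Cycle N).Chain A) (hn : (l ++ m).Nodup) (hX : ∀ z ∈ l ++ m, z ∈ X)
    (hl : ∀ z, C z → z ∈ l ∧ z ∈ P) (ha₀ : C a₀) (h2 : ∀ a, C a → ∃ b, C b ∧ b ≠ a) :
    ∃ a b t u, SplitContour A C X P P a b t u := by
  obtain ⟨s, a, t, rfl, ha, hs⟩ := exists_first_of_mem ⟨a₀, (hl a₀ ha₀).1, ha₀⟩
  obtain ⟨b, hb, hba⟩ := h2 a ha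
  have hbt : b ∈ t := by
    have := (hl b hb).1
    have hbs : b ∉ s := fun h ↦ hs b h hb
    simpa [hbs, hba] using this
  obtain ⟨t, u, rfl⟩ := List.append_of_mem hbt
  have hr : (s ++ a :: (t ++ b :: u) ++ m) ~r (a :: (t ++ b :: (u ++ m ++ s))) := by
    have := List.isRotated_append (l := s) (l' := a :: (t ++ b :: u) ++ m)
    simpa using this
  rw [Cycle.coe_eq_coe.2 hr, chain_cycle_iff] at hc
  refine ⟨a, b, t, u ++ m ++ s, ha, hb, hc.1, Or.inr hc.2, hr.nodup_iff.1 hn,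
    fun z hz ↦ hX z (hr.perm.mem_iff.2 hz), fun z hz ↦ ?_⟩
  obtain ⟨h1, h2⟩ := hl z hz
  have hzs : z ∉ s := fun h ↦ hs z h hz
  simp only [List.mem_append, List.mem_cons, hzs, false_or] at h1 ⊢
  tauto

lemma Contour.exists_split {C : N → Prop} {X P₁ P₂ : Set N} (h : Contour A C X P₁ P₂)
    (h1 : ∃ a, C a) : (∃ a, C a ∧ ∀ z, C z → z = a) ∨ ∃ a b t u,
      SplitContour A C X P₁ P₂ a b t u ∨ SplitContour A C X P₁ P₁ a b t u ∨
        SplitContour A C X P₂ P₂ a b t u := by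
  by_cases h2 : ∃ a, C a ∧ ∀ z, C z → z = a
  · exact Or.inl h2
  push Not at h2
  right
  obtain ⟨a₀, ha₀⟩ := h1
  rcases h with ⟨l, hl, hn, hX, hC⟩ | ⟨l, m, hc, hn, hX, hC⟩
  · obtain ⟨s, a, t, rfl, ha, hs⟩ := exists_first_of_mem ⟨a₀, (hC a₀ ha₀).1, ha₀⟩
    obtain ⟨b, hb, hba⟩ := h2 a ha
    have ht : ∀ z, C z → z ≠ a → z ∈ t := fun z hz hza ↦ by
      have := (hC z hz).1
      have hzs : z ∉ s := fun h ↦ hs z h hz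
      simpa [hzs, hza] using this
    obtain ⟨t, b, u, rfl, hb, hu⟩ := exists_last_of_mem ⟨b, ht b hb hba, hb⟩
    have hn' := hn.of_append_right
    have hsub : (t ++ [b]).Sublist (t ++ b :: u) :=
      List.Sublist.append_left (List.singleton_sublist.2 List.mem_cons_self) t
    refine ⟨a, b, t, [], Or.inr (Or.inl ⟨ha, hb, ?_, Or.inl rfl, ?_, fun z hz ↦ hX z ?_,
      fun z hz ↦ ?_⟩)⟩
    · have := hl.right_of_append
      rw [← List.cons_append, List.isChain_split] at this
      exact this.1
    · exact hn'.sublist (hsub.cons_cons a)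
    · exact List.mem_append_right _ ((hsub.cons_cons a).subset hz)
    · have h3 := (hC z hz).2
      have hzu : z ∉ u := fun h ↦ hu z h hz
      by_cases hza : z = a
      · exact Or.inl ⟨by simp [hza], h3⟩
      · have := ht z hz hza
        simp only [List.mem_append, List.mem_cons, hzu, or_false] at this
        rcases this with h | h
        exacts [Or.inl ⟨List.mem_cons_of_mem _ h, h3⟩, Or.inr ⟨by simp [h], h3⟩]
  · have hr : (l ++ m) ~r (m ++ l) := List.isRotated_append
    by_cases hl : ∃ z ∈ l, C z
    · by_cases hm : ∃ z ∈ m, C z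
      · obtain ⟨s, a, t, rfl, ha, hs⟩ := exists_first_of_mem hl
        obtain ⟨s', b, t', rfl, hb, hs'⟩ := exists_first_of_mem hm
        have hr : (s ++ a :: t ++ (s' ++ b :: t')) ~r (a :: ((t ++ s') ++ b :: (t' ++ s))) := by
          have := List.isRotated_append (l := s) (l' := a :: t ++ (s' ++ b :: t'))
          simpa using this
        rw [Cycle.coe_eq_coe.2 hr, chain_cycle_iff] at hc
        refine ⟨a, b, t ++ s', t' ++ s, Or.inl ⟨ha, hb, hc.1, Or.inr hc.2, hr.nodup_iff.1 hn,
          fun z hz ↦ hX z (hr.perm.mem_iff.2 hz), fun z hz ↦ ?_⟩⟩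
        have hzs : z ∉ s := fun h ↦ hs z h hz
        have hzs' : z ∉ s' := fun h ↦ hs' z h hz
        have := hC z hz
        simp only [List.mem_append, List.mem_cons, hzs, hzs', false_or, or_false] at this ⊢
        tauto
      · obtain ⟨a, b, t, u, h⟩ := exists_split_of_arc hc hn hX
          (fun z hz ↦ (hC z hz).resolve_right fun h ↦ hm ⟨z, h.1, hz⟩) ha₀ h2
        exact ⟨a, b, t, u, Or.inr (Or.inl h)⟩
    · rw [Cycle.coe_eq_coe.2 hr] at hc
      obtain ⟨a, b, t, u, h⟩ := exists_split_of_arc hc (hr.nodup_iff.1 hn)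
        (fun z hz ↦ hX z (hr.perm.mem_iff.2 hz))
        (fun z hz ↦ (hC z hz).resolve_left fun h ↦ hl ⟨z, h.1, hz⟩) ha₀ h2
      exact ⟨a, b, t, u, Or.inr (Or.inr h)⟩

/-- Adding a guarded path between two elements of a contour yields a contour for a connected
set on one side of it. -/
lemma SplitContour.contour (hA : ∀ u v, A u v → A v u) (hK : NoK33Minor A) {C C' : N → Prop}
    {X X' P₁ P₂ P₃ H : Set N} {a b : N} {t u l : List N} (h : SplitContour A C X P₁ P₂ a b t u)
    (hl : (a :: (l ++ [b])).IsChain A) (hn : l.Nodup) (hlX : ∀ z ∈ l, z ∉ X)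
    (ha : a ∈ P₃) (hb : b ∈ P₃) (hlP : ∀ z ∈ l, z ∈ P₃)
    (hX : X ⊆ X') (hlX' : ∀ z ∈ l, z ∈ X') (hC : ∀ z, C' z → C z ∨ z ∈ l)
    (hH : ConnIn A H) (hHX : ∀ z ∈ X', z ∉ H) (hCH : ∀ z, C' z → ∃ y ∈ H, A z y) :
    Contour A C' X' P₁ P₃ ∨ Contour A C' X' P₂ P₃ ∨ Contour A C' X' P₁ P₂ := by
  have hnod := h.nodup
  have hsub := h.subset
  simp only [List.nodup_cons, List.nodup_append, List.mem_append, List.mem_cons] at hnod hsub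
  have hdl : ∀ z ∈ l, z ≠ a ∧ z ≠ b ∧ z ∉ t ∧ z ∉ u := fun z hz ↦
    ⟨fun e ↦ hlX z hz (hsub z (by simp [e])), fun e ↦ hlX z hz (hsub z (by simp [e])),
      fun e ↦ hlX z hz (hsub z (by simp [e])), fun e ↦ hlX z hz (hsub z (by simp [e]))⟩
  by_cases hu : ∀ z ∈ u, ¬ C' z
  · refine Or.inl (Or.inr ⟨a :: t, b :: l.reverse, ?_, ?_, ?_, fun z hz ↦ ?_⟩)
    · exact chain_cycle_iff.2 ⟨h.chain, isChain_reverse_of_symm hA hl⟩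
    · simp only [List.nodup_cons, List.nodup_append, List.mem_cons, List.mem_reverse,
        List.nodup_reverse]
      grind
    · simp only [List.mem_append, List.mem_cons, List.mem_reverse]
      rintro z ((h1 | h1) | h1 | h1)
      exacts [hX (hsub z (by simp [h1])), hX (hsub z (by simp [h1])), hX (hsub z (by simp [h1])),
        hlX' z h1]
    · simp only [List.mem_cons, List.mem_reverse]
      have hzu : z ∉ u := fun h ↦ hu z h hz
      rcases hC z hz with h1 | h1
      · rcases h.guard z h1 with h2 | ⟨h2, -⟩
        · exact Or.inl ⟨by simpa using h2.1, h2.2⟩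
        · have : z = b := by simpa [hzu] using h2
          exact Or.inr ⟨Or.inl this, this ▸ hb⟩
      · exact Or.inr ⟨Or.inr h1, hlP z h1⟩
  have hring := h.chain'.resolve_left (by rintro rfl; simp at hu)
  have htheta := exists_free_of_theta hA hK (a := a) (b := b) (by grind) ![t, u.reverse, l]
    (by
      have := isChain_reverse_of_symm hA hring
      simp [Fin.forall_fin_succ, h.chain, this, hl])
    (by simp [Fin.forall_fin_succ]; grind) (by simp [Fin.forall_fin_succ]; grind)
    (by
      intro i j hij z h1 h2
      fin_cases i <;> fin_cases j <;> simp at h1 h2 hij <;> grind)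
    hH (hHX a (hX (hsub a (by simp)))) (hHX b (hX (hsub b (by simp))))
    (by
      intro j z hz
      refine hHX z ?_
      fin_cases j <;> simp at hz
      exacts [hX (hsub z (by simp [hz])), hX (hsub z (by simp [hz])), hlX' z hz])
  obtain ⟨j, hj⟩ := htheta
  have hj' : ∀ z, C' z → z ∉ ![t, u.reverse, l] j := fun z hz hzj ↦ hj z hzj (hCH z hz)
  fin_cases j
  · refine Or.inr (Or.inl (Or.inr ⟨b :: u, a :: l, ?_, ?_, ?_, fun z hz ↦ ?_⟩))
    · exact chain_cycle_iff.2 ⟨hring, hl⟩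
    · simp only [List.nodup_cons, List.nodup_append, List.mem_cons]
      grind
    · simp only [List.mem_append, List.mem_cons]
      rintro z ((h1 | h1) | h1 | h1)
      exacts [hX (hsub z (by simp [h1])), hX (hsub z (by simp [h1])), hX (hsub z (by simp [h1])),
        hlX' z h1]
    · have hzt : z ∉ t := hj' z hz
      rcases hC z hz with h1 | h1
      · rcases h.guard z h1 with ⟨h2, -⟩ | h2
        · have : z = a := by simpa [hzt] using h2
          exact Or.inr ⟨by simp [this], this ▸ ha⟩
        · exact Or.inl h2
      · exact Or.inr ⟨List.mem_cons_of_mem _ h1, hlP z h1⟩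
  · exact (hu fun z h1 h2 ↦ hj' z h2 (List.mem_reverse.2 h1)).elim
  · exact Or.inr (Or.inr (Or.inr ⟨a :: t, b :: u, chain_cycle_iff.2 ⟨h.chain, hring⟩, h.nodup,
      fun z hz ↦ hX (h.subset z hz), fun z hz ↦ h.guard z ((hC z hz).resolve_right (hj' z hz))⟩))

end Contour

section Territory

open Relation

variable {V : Type} {G : SimpleGraph V} {D : Type*} {S : HubSystem G D}
  {X X' : Set (V ⊕ D)} {R R' : Set V}

variable (S X R) in
/-- `R` is a region in which the robber is confined by `X`. -/
structure HubSystem.Territory : Prop where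
  notMem : ∀ r ∈ R, Sum.inl r ∉ X
  conn : ∀ r ∈ R, ∀ w ∈ R, ReflTransGen (S.Free X R) r w
  closed : ∀ r ∈ R, ∀ w, G.Adj r w → S.Via X r w → Sum.inl w ∉ X → w ∈ R

lemma HubSystem.Via.symm {u v : V} (h : S.Via X u v) : S.Via X v u :=
  let ⟨d, h1, h2, h3⟩ := h
  ⟨d, h1, h3, h2⟩

lemma HubSystem.Free.symm {u v : V} (h : S.Free X R u v) : S.Free X R v u :=
  ⟨h.2.1, h.1, h.2.2.1.symm, h.2.2.2.symm⟩

variable (S X) in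
lemma HubSystem.exists_territory {r : V} (hr : Sum.inl r ∉ X) :
    ∃ R, S.Territory X R ∧ r ∈ R := by
  let A : V → V → Prop := fun u w ↦ G.Adj u w ∧ S.Via X u w ∧ Sum.inl w ∉ X
  have hsub : ∀ w, ReflTransGen A r w →
      ReflTransGen (S.Free X {w | ReflTransGen A r w}) r w := by
    intro w hw
    induction hw with
    | refl => exact .refl
    | tail h1 h2 ih => exact ih.tail ⟨h1, h1.tail h2, h2.1, h2.2.1⟩
  refine ⟨{w | ReflTransGen A r w}, ⟨fun w hw ↦ ?_, fun u hu w hw ↦ ?_,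
    fun u hu w h1 h2 h3 ↦ hu.tail ⟨h1, h2, h3⟩⟩, .refl⟩
  · rcases hw.cases_tail with rfl | ⟨_, -, h⟩
    exacts [hr, h.2.2]
  · have : Std.Symm (S.Free X {w | ReflTransGen A r w}) := ⟨fun _ _ ↦ HubSystem.Free.symm⟩
    exact (ReflTransGen.stdSymm.symm _ _ (hsub u hu)).trans (hsub w hw)

lemma HubSystem.Territory.subset (h : S.Territory X R) (h' : S.Territory X' R') (hX : X ⊆ X')
    {r : V} (hr : r ∈ R) (hr' : r ∈ R') : R' ⊆ R := by
  intro w hw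
  have := h'.conn r hr' w hw
  clear hw
  induction this with
  | refl => exact hr
  | tail _ h2 ih =>
    exact h.closed _ ih _ h2.2.2.1 (h2.2.2.2.mono hX) fun hx ↦ h'.notMem _ h2.2.1 (hX hx)

lemma HubSystem.hat_mono (hX : X ⊆ X') (hR : R' ⊆ R) : S.hat X' R' ⊆ S.hat X R := by
  rintro z (⟨r, hr, rfl⟩ | ⟨d, rfl, hd, r, hr, hrd⟩)
  exacts [Or.inl ⟨r, hR hr, rfl⟩, Or.inr ⟨d, rfl, fun h ↦ hd (hX h), r, hR hr, hrd⟩]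

lemma HubSystem.Contact.mem {z : V ⊕ D} (h : S.Contact X R z) : z ∈ X := by
  rcases h with ⟨w, rfl, h, -⟩ | ⟨d, rfl, h, -⟩ <;> exact h

lemma HubSystem.Contact.anti {z : V ⊕ D} (h : S.Contact X' R' z) (hX : X ⊆ X') (hR : R' ⊆ R)
    (hz : z ∈ X) : S.Contact X R z := by
  rcases h with ⟨w, rfl, -, r, hr, h1, h2⟩ | ⟨d, rfl, -, r, hr, h⟩
  exacts [Or.inl ⟨w, rfl, hz, r, hR hr, h1, h2.mono hX⟩, Or.inr ⟨d, rfl, hz, r, hR hr, h⟩]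

lemma HubSystem.Contact.exists_inc {z : V ⊕ D} (h : S.Contact X R z) :
    ∃ y ∈ S.hat X R, Inc S.T z y := by
  rcases h with ⟨w, rfl, -, r, hr, -, d, hd, hrd, hwd⟩ | ⟨d, rfl, -, r, hr, h⟩
  exacts [⟨.inr d, Or.inr ⟨d, rfl, hd, r, hr, hrd⟩, hwd⟩, ⟨.inl r, Or.inl ⟨r, hr, rfl⟩, h⟩]

namespace HubSystem.Territory

lemma notMem_hat (h : S.Territory X R) {z : V ⊕ D} (hz : z ∈ X) : z ∉ S.hat X R := by
  rintro (⟨r, hr, rfl⟩ | ⟨d, rfl, hd, -⟩)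
  exacts [h.notMem r hr hz, hd hz]

lemma connIn_hat (h : S.Territory X R) : ConnIn (Inc S.T) (S.hat X R) := by
  have hsymm : Std.Symm fun u v ↦ Inc S.T u v ∧ u ∈ S.hat X R ∧ v ∈ S.hat X R :=
    ⟨fun _ _ h ↦ ⟨h.1.symm, h.2.2, h.2.1⟩⟩
  have h1 : ∀ z ∈ S.hat X R, ∃ r ∈ R, ReflTransGen
      (fun u v ↦ Inc S.T u v ∧ u ∈ S.hat X R ∧ v ∈ S.hat X R) (.inl r) z := by
    rintro z (⟨r, hr, rfl⟩ | ⟨d, rfl, hd, r, hr, hrd⟩)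
    · exact ⟨r, hr, .refl⟩
    · exact ⟨r, hr, .single ⟨hrd, Or.inl ⟨r, hr, rfl⟩, Or.inr ⟨d, rfl, hd, r, hr, hrd⟩⟩⟩
  have h2 : ∀ r ∈ R, ∀ w ∈ R, ReflTransGen
      (fun u v ↦ Inc S.T u v ∧ u ∈ S.hat X R ∧ v ∈ S.hat X R) (.inl r) (.inl w) := by
    intro r hr w hw
    have := h.conn r hr w hw
    clear hw
    induction this with
    | refl => exact .refl
    | @tail u v _ huv ih =>
      obtain ⟨hu, hv, -, d, hd, hud, hvd⟩ := huv
      have hd' : Sum.inr d ∈ S.hat X R := Or.inr ⟨d, rfl, hd, u, hu, hud⟩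
      have h1 : Inc S.T (.inl u) (.inr d) := hud
      have h2 : Inc S.T (.inr d) (.inl v) := hvd
      exact (ih.tail ⟨h1, Or.inl ⟨u, hu, rfl⟩, hd'⟩).tail ⟨h2, hd', Or.inl ⟨v, hv, rfl⟩⟩
  intro a ha b hb
  obtain ⟨r, hr, har⟩ := h1 a ha
  obtain ⟨w, hw, hbw⟩ := h1 b hb
  exact ((ReflTransGen.stdSymm.symm _ _ har).trans (h2 r hr w hw)).trans hbw

lemma exit (h : S.Territory X R)
    {r w : V} (hr : r ∈ R) (hrw : G.Adj r w) :
    S.Free X R r w ∨ (S.Contact X R (.inl w) ∧ S.Via X r w) ∨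
      ∃ d, S.Contact X R (.inr d) ∧ r ∈ S.T d ∧ w ∈ S.T d := by
  by_cases hv : S.Via X r w
  · by_cases hw : Sum.inl w ∈ X
    · exact Or.inr (Or.inl ⟨Or.inl ⟨w, rfl, hw, r, hr, hrw, hv⟩, hv⟩)
    · exact Or.inl ⟨hr, h.closed r hr w hrw hv hw, hrw, hv⟩
  · obtain ⟨d, h1, h2⟩ := S.cover r w hrw
    have hd : Sum.inr d ∈ X := by
      by_contra hd
      exact hv ⟨d, hd, h1, h2⟩
    exact Or.inr (Or.inr ⟨d, Or.inr ⟨d, rfl, hd, r, hr, h1⟩, h1, h2⟩)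

lemma exists_contact (h : S.Territory X R)
    (hconn : G.Connected) {r v : V} (hr : r ∈ R) (hv : Sum.inl v ∈ X) :
    ∃ a, S.Contact X R a := by
  obtain ⟨p⟩ := hconn.preconnected r v
  obtain ⟨d, -, h1, h2⟩ := p.exists_boundary_dart R hr fun h' ↦ h.notMem v h' hv
  rcases h.exit h1 d.adj with h3 | ⟨h3, -⟩ | ⟨_, h3, -⟩
  exacts [(h2 h3.2.1).elim, ⟨_, h3⟩, ⟨_, h3⟩]

lemma guarding (h : S.Territory X R)
    {g : Fin 3 → Fin 7 → V → V} {Hot : Fin 3 → Set V} {P : Fin 3 → Set (V ⊕ D)}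
    {T : Set (Fin 3)} (hg : ∀ τ ∈ T, TeamGuards S X R (g τ) (Hot τ) (P τ))
    (hP : ∀ z, S.Contact X R z → ∃ τ ∈ T, z ∈ P τ) :
    Guarding G {r | r ∈ R ∧ ∀ τ ∈ T, r ∉ Hot τ} (fun r w ↦ r = w ∨ S.Free X R r w)
      {i : Fin 3 × Fin 7 | i.1 ∈ T} (fun i ↦ g i.1 i.2) := by
  have key : ∀ {τ r w}, τ ∈ T → (∃ j, Near G (g τ j r) w) →
      ∃ i ∈ {i : Fin 3 × Fin 7 | i.1 ∈ T}, Near G (g i.1 i.2 r) w := by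
    rintro τ r w hτ ⟨j, hj⟩
    exact ⟨(τ, j), hτ, hj⟩
  rintro r ⟨hr, hcold⟩ w (rfl | hrw)
  · exact Or.inl ⟨⟨hr, hcold⟩, Or.inl rfl⟩
  rcases h.exit hr hrw with hf | ⟨hc, hv⟩ | ⟨d, hc, h1, h2⟩
  · by_cases hw : ∀ τ ∈ T, w ∉ Hot τ
    · exact Or.inl ⟨⟨hf.2.1, hw⟩, Or.inr hf⟩
    · push Not at hw
      obtain ⟨τ, hτ, hw⟩ := hw
      exact Or.inr (key hτ ((hg τ hτ).hot r w hf hw))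
  · obtain ⟨τ, hτ, hz⟩ := hP _ hc
    exact Or.inr (key hτ ((hg τ hτ).vertex r w hz hr hrw hv))
  · obtain ⟨τ, hτ, hz⟩ := hP _ hc
    exact Or.inr (key hτ ((hg τ hτ).block d r w hz hr h1 (hcold τ hτ) h2 hrw))

end HubSystem.Territory

/-- A further team takes up its guard while the teams in `T` hold theirs. -/
lemma win_of_refine [Finite V] {X : Set (V ⊕ D)} {R : Set V} (hconn : G.Connected)
    (hR : S.Territory X R) {g : Fin 3 → Fin 7 → V → V} {Hot : Fin 3 → Set V}
    {P : Fin 3 → Set (V ⊕ D)} {T : Set (Fin 3)}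
    (hg : ∀ τ ∈ T, TeamGuards S X R (g τ) (Hot τ) (P τ))
    (hP : ∀ z, S.Contact X R z → ∃ τ ∈ T, z ∈ P τ) {τ₃ : Fin 3}
    (hg₃ : TeamGuards S X R (g τ₃) (Hot τ₃) (P τ₃))
    (ht₃ : ∀ j, Tracker G (fun r w ↦ r = w ∨ S.Free X R r w) (g τ₃ j))
    {c : Fin 3 × Fin 7 → V} {r : V} (hr : r ∈ R) (hcold : ∀ τ ∈ T, r ∉ Hot τ)
    (hc : ∀ τ ∈ T, ∀ j, Near G (c (τ, j)) (g τ j r))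
    (h : ∀ c r, r ∈ R → (∀ τ, τ = τ₃ ∨ τ ∈ T → r ∉ Hot τ ∧ ∀ j, Near G (c (τ, j)) (g τ j r)) →
      Win G c r) : Win G c r := by
  have hG := hR.guarding hg hP
  have hM : ∀ τ, τ = τ₃ ∨ τ ∈ T → ∀ j r w, (r = w ∨ S.Free X R r w) →
      Near G (g τ j r) (g τ j w) := by
    rintro τ hτ j r w (rfl | hf)
    · exact Near.refl _
    · rcases hτ with rfl | hτ
      exacts [hg₃.near r w hf j, (hg τ hτ).near r w hf j]
  refine Win.acquire_finset hconn hG (fun i hi ↦ hM i.1 (Or.inr hi) i.2)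
    ({τ₃} ×ˢ Finset.univ) (fun i hi ↦ ?_) (fun c r hr hc ↦ ?_) c r ⟨hr, hcold⟩
    fun i hi ↦ hc i.1 hi i.2
  · obtain ⟨τ, j⟩ := i
    obtain rfl : τ₃ = τ := by simpa using hi
    exact ht₃ j
  · have hG' : Guarding G {r | r ∈ R ∧ ∀ τ ∈ T, r ∉ Hot τ} (fun r w ↦ r = w ∨ S.Free X R r w)
        {i : Fin 3 × Fin 7 | i.1 = τ₃ ∨ i.1 ∈ T} (fun i ↦ g i.1 i.2) := fun r hr w hw ↦
      (hG r hr w hw).imp_right fun ⟨i, hi, h⟩ ↦ ⟨i, Or.inr hi, h⟩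
    refine Win.guard_step hG' hr (answer {i : Fin 3 × Fin 7 | i.1 = τ₃ ∨ i.1 ∈ T}
      (fun i ↦ g i.1 i.2) c r) (fun i ↦ ?_) (fun i hi ↦ by rw [answer, if_pos hi])
      fun w hw hrw ↦ ?_
    · unfold answer
      split_ifs with hi
      · exact hc i (hi.imp_left fun h ↦ by simp [← h])
      · exact Near.refl _
    · have hans : ∀ τ, τ = τ₃ ∨ τ ∈ T → ∀ j, answer {i : Fin 3 × Fin 7 | i.1 = τ₃ ∨ i.1 ∈ T}
          (fun i ↦ g i.1 i.2) c r (τ, j) = g τ j r := fun τ hτ j ↦ if_pos hτ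
      by_cases hw₃ : w ∈ Hot τ₃
      · have : ∃ j, Near G (g τ₃ j r) w := by
          rcases hrw with rfl | hf
          exacts [hg₃.stay r hr.1 hw₃, hg₃.hot r w hf hw₃]
        obtain ⟨j, hj⟩ := this
        exact Win.of_near (i := (τ₃, j)) (by rwa [hans τ₃ (Or.inl rfl)])
      · refine h _ w hw.1 fun τ hτ ↦ ⟨?_, fun j ↦ ?_⟩
        · rcases hτ with rfl | hτ
          exacts [hw₃, hw.2 τ hτ]
        · rw [hans τ hτ]
          exact hM τ hτ j r w hrw

/-- The cops win if all contacts lie on a path or cycle guarded by at most two teams. -/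
theorem win_of_contour [Finite V] [Finite D] (hconn : G.Connected) :
    ∀ (n : ℕ) (X : Set (V ⊕ D)) (R : Set V) (g : Fin 3 → Fin 7 → V → V) (Hot : Fin 3 → Set V)
      (P : Fin 3 → Set (V ⊕ D)) (T : Set (Fin 3)) (τ₁ τ₂ : Fin 3) (c : Fin 3 × Fin 7 → V) (r : V),
      (S.hat X R).ncard < n → S.Territory X R → r ∈ R → (∃ v, Sum.inl v ∈ X) →
      τ₁ ∈ T → τ₂ ∈ T →
      (∀ τ ∈ T, TeamGuards S X R (g τ) (Hot τ) (P τ)) → (∀ τ ∈ T, r ∉ Hot τ) →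
      (∀ τ ∈ T, ∀ j, Near G (c (τ, j)) (g τ j r)) →
      Contour (Inc S.T) (S.Contact X R) X (P τ₁) (P τ₂) → Win G c r := by
  intro n
  induction n with
  | zero => exact fun _ _ _ _ _ _ _ _ _ _ h ↦ (Nat.not_lt_zero _ h).elim
  | succ n ih =>
  intro X R g Hot P T τ₁ τ₂ c r hn hR hr hX hτ₁ hτ₂ hg hcold hc hcon
  obtain ⟨v, hv⟩ := hX
  -- Only the two teams in use are kept.
  have hex : ∃ a, S.Contact X R a := hR.exists_contact hconn hr hv
  have hT : ∀ τ, τ = τ₁ ∨ τ = τ₂ → τ ∈ T := by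
    rintro τ (rfl | rfl) <;> assumption
  obtain ⟨τ₃, hτ₃⟩ : ∃ τ₃ : Fin 3, τ₃ ≠ τ₁ ∧ τ₃ ≠ τ₂ :=
    (by decide : ∀ τ₁ τ₂ : Fin 3, ∃ τ₃, τ₃ ≠ τ₁ ∧ τ₃ ≠ τ₂) τ₁ τ₂
  have hpair : ∃ a b, S.Contact X R a ∧ S.Contact X R b ∧
      ((a = b ∧ ∀ z, S.Contact X R z → z = a) ∨ a ≠ b ∧ ∃ t u σ₁ σ₂,
        (σ₁ = τ₁ ∨ σ₁ = τ₂) ∧ (σ₂ = τ₁ ∨ σ₂ = τ₂) ∧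
        SplitContour (Inc S.T) (S.Contact X R) X (P σ₁) (P σ₂) a b t u) := by
    rcases hcon.exists_split hex with ⟨a, ha, h⟩ | ⟨a, b, t, u, h⟩
    · exact ⟨a, a, ha, ha, Or.inl ⟨rfl, h⟩⟩
    · have key : ∀ P₁ P₂, SplitContour (Inc S.T) (S.Contact X R) X P₁ P₂ a b t u →
          S.Contact X R a ∧ S.Contact X R b ∧ a ≠ b := fun P₁ P₂ h ↦
        ⟨h.left, h.right, by have := h.nodup; simp at this; grind⟩
      rcases h with h | h | h <;> obtain ⟨h1, h2, h3⟩ := key _ _ h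
      exacts [⟨a, b, h1, h2, Or.inr ⟨h3, t, u, τ₁, τ₂, Or.inl rfl, Or.inr rfl, h⟩⟩,
        ⟨a, b, h1, h2, Or.inr ⟨h3, t, u, τ₁, τ₁, Or.inl rfl, Or.inl rfl, h⟩⟩,
        ⟨a, b, h1, h2, Or.inr ⟨h3, t, u, τ₂, τ₂, Or.inr rfl, Or.inr rfl, h⟩⟩]
  obtain ⟨a, b, ha, hb, hab⟩ := hpair
  obtain ⟨g₃, Hot₃, P₃, l, hg₃, ht₃, haP, hbP, hl, hch, hch', hnod, hlP, hlhat, hlHot⟩ :=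
    exists_team_of_contacts hR.notMem hR.conn ha hb
  have e₁ : ∀ τ, τ = τ₁ ∨ τ = τ₂ → τ ≠ τ₃ := by
    rintro τ (rfl | rfl)
    exacts [hτ₃.1.symm, hτ₃.2.symm]
  obtain ⟨g', hg'₃, hg'⟩ : ∃ g' : Fin 3 → Fin 7 → V → V, g' τ₃ = g₃ ∧ ∀ τ, τ ≠ τ₃ → g' τ = g τ :=
    ⟨Function.update g τ₃ g₃, by simp, fun τ h ↦ by simp [h]⟩
  obtain ⟨Hot', hHot'₃, hHot'⟩ : ∃ Hot' : Fin 3 → Set V, Hot' τ₃ = Hot₃ ∧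
      ∀ τ, τ ≠ τ₃ → Hot' τ = Hot τ :=
    ⟨Function.update Hot τ₃ Hot₃, by simp, fun τ h ↦ by simp [h]⟩
  obtain ⟨P', hP'₃, hP'⟩ : ∃ P' : Fin 3 → Set (V ⊕ D), P' τ₃ = P₃ ∧ ∀ τ, τ ≠ τ₃ → P' τ = P τ :=
    ⟨Function.update P τ₃ P₃, by simp, fun τ h ↦ by simp [h]⟩
  have hgT : ∀ τ ∈ {τ | τ = τ₁ ∨ τ = τ₂}, TeamGuards S X R (g' τ) (Hot' τ) (P' τ) := by
    intro τ hτ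
    rw [hg' τ (e₁ τ hτ), hHot' τ (e₁ τ hτ), hP' τ (e₁ τ hτ)]
    exact hg τ (hT τ hτ)
  have hg₃' : TeamGuards S X R (g' τ₃) (Hot' τ₃) (P' τ₃) := by
    rwa [hg'₃, hHot'₃, hP'₃]
  refine win_of_refine hconn hR (T := {τ | τ = τ₁ ∨ τ = τ₂}) (τ₃ := τ₃) hgT (fun z hz ↦ ?_) hg₃'
    (by rwa [hg'₃]) hr (fun τ hτ ↦ ?_) (fun τ hτ ↦ ?_) fun c r hr hcold ↦ ?_
  · rcases hcon.mem hz with h | h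
    · exact ⟨τ₁, Or.inl rfl, by rwa [hP' τ₁ (e₁ τ₁ (Or.inl rfl))]⟩
    · exact ⟨τ₂, Or.inr rfl, by rwa [hP' τ₂ (e₁ τ₂ (Or.inr rfl))]⟩
  · rw [hHot' τ (e₁ τ hτ)]
    exact hcold τ (hT τ hτ)
  · rw [hg' τ (e₁ τ hτ)]
    exact hc τ (hT τ hτ)
  clear hc
  have hXX : X ⊆ X ∪ {z | z ∈ l} := Set.subset_union_left
  have hrX : Sum.inl r ∉ X ∪ {z | z ∈ l} := by
    rintro (h | h)
    · exact hR.notMem r hr h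
    · exact (hcold τ₃ (Or.inl rfl)).1 (hHot'₃ ▸ hlHot r h)
  obtain ⟨R', hR', hr'⟩ := S.exists_territory (X ∪ {z | z ∈ l}) hrX
  have hsub : R' ⊆ R := hR.subset hR' hXX hr hr'
  have hcontact : ∀ z, S.Contact (X ∪ {z | z ∈ l}) R' z → S.Contact X R z ∨ z ∈ l := fun z hz ↦
    hz.mem.imp_left (hz.anti hXX hsub)
  have hlX : ∀ z ∈ l, z ∉ X := fun z hz h ↦ hR.notMem_hat h (hlhat z hz)
  have hlt : (S.hat (X ∪ {z | z ∈ l}) R').ncard < n := by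
    obtain ⟨z, hz⟩ := List.exists_mem_of_ne_nil l hl
    refine lt_of_lt_of_le (Set.ncard_lt_ncard ?_ (Set.toFinite _)) (Nat.lt_succ_iff.1 hn)
    refine (Set.ssubset_iff_of_subset (HubSystem.hat_mono hXX hsub)).2 ⟨z, hlhat z hz, ?_⟩
    exact hR'.notMem_hat (Or.inr hz)
  have key : ∀ σ₁ σ₂, (σ₁ = τ₃ ∨ σ₁ = τ₁ ∨ σ₁ = τ₂) → (σ₂ = τ₃ ∨ σ₂ = τ₁ ∨ σ₂ = τ₂) →
      Contour (Inc S.T) (S.Contact (X ∪ {z | z ∈ l}) R') (X ∪ {z | z ∈ l}) (P' σ₁) (P' σ₂) →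
      Win G c r := fun σ₁ σ₂ h1 h2 hcon ↦
    ih _ R' g' Hot' P' {τ | τ = τ₃ ∨ τ = τ₁ ∨ τ = τ₂} σ₁ σ₂ c r hlt hR' hr' ⟨v, Or.inl hv⟩ h1 h2
      (fun τ hτ ↦ TeamGuards.mono (by
        rcases hτ with rfl | hτ
        exacts [hg₃', hgT τ hτ]) hXX hsub subset_rfl)
      (fun τ hτ ↦ (hcold τ hτ).1) (fun τ hτ ↦ (hcold τ hτ).2) hcon
  rcases hab with ⟨rfl, hone⟩ | ⟨hab, t, u, σ₁, σ₂, hσ₁, hσ₂, hsplit⟩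
  · refine key τ₃ τ₃ (Or.inl rfl) (Or.inl rfl) (Or.inl ⟨a :: l, hch, ?_, ?_, fun z hz ↦ ?_⟩)
    · exact List.nodup_cons.2 ⟨fun h ↦ hlX a h ha.mem, hnod⟩
    · exact List.forall_mem_cons.2 ⟨Or.inl ha.mem, fun z hz ↦ Or.inr hz⟩
    · rw [hP'₃]
      rcases hcontact z hz with h | h
      · rw [hone z h]
        exact ⟨List.mem_cons_self, haP⟩
      · exact ⟨List.mem_cons_of_mem _ h, hlP z h⟩
  · have := hsplit.contour (fun _ _ ↦ Inc.symm) S.noK33 (P₃ := P₃) (hch' hab) hnod hlX haP hbP hlP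
      hXX (fun z hz ↦ Or.inr hz) hcontact hR'.connIn_hat (fun z hz ↦ hR'.notMem_hat hz)
      fun z hz ↦ hz.exists_inc
    rw [← hP'₃, ← hP' σ₁ (e₁ σ₁ hσ₁), ← hP' σ₂ (e₁ σ₂ hσ₂)] at this
    rcases this with h | h | h
    exacts [key σ₁ τ₃ (Or.inr hσ₁) (Or.inl rfl) h, key σ₂ τ₃ (Or.inr hσ₂) (Or.inl rfl) h,
      key σ₁ σ₂ (Or.inr hσ₁) (Or.inr hσ₂) h]

/-- Three teams of seven cops win on any connected graph covered by a hub system. -/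
theorem HubSystem.copsWin [Finite V] [Finite D] (S : HubSystem G D) (hconn : G.Connected) :
    CopsWin G 21 := by
  obtain ⟨v⟩ := hconn.nonempty
  refine copsWin_of_win (ι := Fin 3 × Fin 7) (finProdFinEquiv (m := 3) (n := 7)).symm
    (fun _ ↦ v) fun r ↦ ?_
  by_cases hr : Near G v r
  · exact Win.of_near (i := (0, 0)) hr
  have hX : (Sum.inl r : V ⊕ D) ∉ ({.inl v} : Set (V ⊕ D)) := by
    rintro ⟨⟩
    exact hr (Near.refl _)
  obtain ⟨R, hR, hrR⟩ := S.exists_territory _ hX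
  refine win_of_contour (S := S) hconn _ {.inl v} R (fun _ _ _ ↦ v) (fun _ ↦ {w | Near G v w})
    (fun _ ↦ {.inl v}) Set.univ 0 0 _ r (Nat.lt_succ_self _) hR hrR ⟨v, rfl⟩ trivial trivial
    (fun _ _ ↦ ?_) (fun _ _ ↦ hr) (fun _ _ _ ↦ Near.refl _) (Or.inl ⟨[.inl v], by simp, by simp,
      by simp, fun z hz ↦ ?_⟩)
  · refine ⟨fun _ _ _ _ ↦ Near.refl _, fun _ _ _ h ↦ ⟨0, h⟩, fun _ _ h ↦ ⟨0, h⟩, ?_, ?_⟩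
    · rintro d _ _ ⟨⟩
    · rintro _ _ ⟨⟩ - - -
      exact ⟨0, Near.refl _⟩
  · have := hz.mem
    exact ⟨by simpa using this, this⟩

end Territory

/-- Any finite connected graph admitting a 1-planar drawing in
the plane with no ×-crossings (i.e. `G ∈ Ĝ`) has cop number at most 21. -/
theorem copNumber_le_21_of_onePlanar_no_xcrossings
    {V : Type} [Fintype V] (G : SimpleGraph V) (hconn : G.Connected)
    (D : OnePlanarDrawing G)
    (hnoX : ∀ e f : Sym2 V, ¬ D.IsXCrossing e f) :
    copNumber G ≤ 21 := by
  exact Nat.sInf_le ((D.hubSystem hnoX).copsWin hconn)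

end CopsRobbersOnePlanar
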